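/- arXiv:1609.03693 — 3 statements merged into one kernel-verified Lean document; each statement's English description precedes it below -/
import Mathlib

section
/- (Monotonicity of the solution in time, Dirichlet case) Let β ∈ (0,1), Ω ⊂ ℝ^n bounded open with smooth boundary, A elliptic with a_{ij}, a_j ∈ C(Ω̄), and z ∈ C(Ω̄). Let u solve D^β[u − u_0] = Au + a(u,t,x) z(x) + b(u,t,x) on (0,T)×Ω with u(0,·) = u_0 and u = g on (0,T)×∂Ω. Assume: u ∈ C([0,T]×Ω̄); u, u_{x_j}, u_{x_i x_j} ∈ C^{β''}([0,T];L_1(Ω)) for some β'' > 1−β; u_t ∈ C^{β'}([0,T];C(Ω̄)) for some β' > β; u_{t x_j}, u_{t x_i x_j} ∈ C((0,T]×Ω̄); a, b ∈ C(ℝ; C^{β''}([0,T];L_∞(Ω))); a_w, b_w, a_t, b_t ∈ C(ℝ×[0,T]×Ω̄); a(u_0(x),0,x) = 0 and A(x)u_0(x) + b(u_0(x),0,x) = 0 on Ω; g_t ≥ 0 on (0,T)×∂Ω; and a_t(u(t,x),t,x) z(x) + b_t(u(t,x),t,x) ≥ 0 on (0,T)×Ω. Then u_t ≥ 0 on [0,T]×Ω̄.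 -/
open Set MeasureTheory Filter Topology ENNReal

/-- Partial derivative `∂v/∂x_i`. -/
noncomputable def pd {n : ℕ} (i : Fin n) (v : (Fin n → ℝ) → ℝ) (x : Fin n → ℝ) : ℝ :=
  fderiv ℝ v x (Pi.single i 1)

/-- The second order operator
`A(x)v = Σ_{i,j} a_{ij}(x) ∂²v/∂x_i∂x_j + Σ_j a_j(x) ∂v/∂x_j`. -/
noncomputable def ellOp {n : ℕ} (aC : Fin n → Fin n → (Fin n → ℝ) → ℝ)
    (bC : Fin n → (Fin n → ℝ) → ℝ) (v : (Fin n → ℝ) → ℝ) (x : Fin n → ℝ) : ℝ :=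
  (∑ i, ∑ j, aC i j x * pd i (pd j v) x) + ∑ j, bC j x * pd j v x

/-- Uniform ellipticity: `Σ_{i,j} a_{ij}(x) ξ_i ξ_j ≥ c |ξ|²` on `Ω`. -/
def IsElliptic {n : ℕ} (aC : Fin n → Fin n → (Fin n → ℝ) → ℝ) (Ω : Set (Fin n → ℝ)) : Prop :=
  ∃ c > 0, ∀ x ∈ Ω, ∀ ξ : Fin n → ℝ, c * ∑ i, ξ i ^ 2 ≤ ∑ i, ∑ j, aC i j x * ξ i * ξ j

/-- Riemann–Liouville fractional derivative of order `β`
(derivative within `[0,T]`, one-sided at the endpoints). -/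
noncomputable def RLD (β T : ℝ) (w : ℝ → ℝ) (t : ℝ) : ℝ :=
  derivWithin (fun s => (Real.Gamma (1 - β))⁻¹ * ∫ τ in (0:ℝ)..s, (s - τ) ^ (-β) * w τ)
    (Icc 0 T) t

/-- `L_p(Ω)`-norm (as an extended real). -/
noncomputable def nLp {n : ℕ} (p : ℝ≥0∞) (Ω : Set (Fin n → ℝ)) (v : (Fin n → ℝ) → ℝ) : ℝ≥0∞ :=
  eLpNorm v p (volume.restrict Ω)

/-- `L_∞(Ω)`-norm. -/
noncomputable def nLinf {n : ℕ} (Ω : Set (Fin n → ℝ)) (v : (Fin n → ℝ) → ℝ) : ℝ≥0∞ :=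
  eLpNorm v ⊤ (volume.restrict Ω)

/-- Sup-norm of `v` over `Ω̄` (the `C(Ω̄)`-norm, as an extended real). -/
noncomputable def nC0 {n : ℕ} (Ω : Set (Fin n → ℝ)) (v : (Fin n → ℝ) → ℝ) : ℝ≥0∞ :=
  ⨆ x ∈ closure Ω, ENNReal.ofReal |v x|

/-- The `C^δ(Ω̄)` Hölder norm of `v` (as an extended real; the quotient is read as `0`
when `x = y`). -/
noncomputable def nC {n : ℕ} (δ : ℝ) (Ω : Set (Fin n → ℝ)) (v : (Fin n → ℝ) → ℝ) : ℝ≥0∞ :=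
  (⨆ x ∈ closure Ω, ENNReal.ofReal |v x|) +
    ⨆ x ∈ closure Ω, ⨆ y ∈ closure Ω,
      ENNReal.ofReal |v x - v y| / ENNReal.ofReal (‖x - y‖ ^ δ)

/-- The `C^{2+δ}(Ω̄)` norm of `v`. -/
noncomputable def nC2 {n : ℕ} (δ : ℝ) (Ω : Set (Fin n → ℝ)) (v : (Fin n → ℝ) → ℝ) : ℝ≥0∞ :=
  nC δ Ω v + (∑ j, nC δ Ω (pd j v)) + ∑ i, ∑ j, nC δ Ω (pd i (pd j v))

/-- `L_∞((0,T) × Ω)`-norm of a space-time function. -/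
noncomputable def nLinfTX {n : ℕ} (T : ℝ) (Ω : Set (Fin n → ℝ))
    (f : ℝ → (Fin n → ℝ) → ℝ) : ℝ≥0∞ :=
  eLpNorm (fun p : ℝ × (Fin n → ℝ) => f p.1 p.2) ⊤ (volume.restrict (Ioo 0 T ×ˢ Ω))

/-- `L_∞((0,T); C^δ(Ω̄))`-norm of a space-time function. -/
noncomputable def nLinfC {n : ℕ} (δ T : ℝ) (Ω : Set (Fin n → ℝ))
    (f : ℝ → (Fin n → ℝ) → ℝ) : ℝ≥0∞ :=
  ⨆ t ∈ Ioo (0:ℝ) T, nC δ Ω (f t)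

/-- Pointwise time derivative (within `[0,T]`) of a space-time function. -/
noncomputable def tderiv {n : ℕ} (T : ℝ) (u : ℝ → (Fin n → ℝ) → ℝ)
    (t : ℝ) (x : Fin n → ℝ) : ℝ :=
  derivWithin (fun τ => u τ x) (Icc 0 T) t

/-- Hölder quotient seminorm in time, with respect to a space norm `N`. -/
noncomputable def hQuot {n : ℕ} (γ T : ℝ) (N : ((Fin n → ℝ) → ℝ) → ℝ≥0∞)
    (u : ℝ → (Fin n → ℝ) → ℝ) : ℝ≥0∞ :=
  ⨆ s ∈ Icc (0:ℝ) T, ⨆ t ∈ Icc (0:ℝ) T,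
    N (fun x => u t x - u s x) / ENNReal.ofReal (|t - s| ^ γ)

/-- The `C^γ([0,T];X)`-norm, where the space `X` is described by the norm functional `N`.
For `γ ∈ (0,1]` this is the usual Hölder norm; for `γ ∈ (1,2)` it is the norm of
`C^{1,γ-1}`, computed with the (pointwise) time derivative. -/
noncomputable def hNorm {n : ℕ} (γ T : ℝ) (N : ((Fin n → ℝ) → ℝ) → ℝ≥0∞)
    (u : ℝ → (Fin n → ℝ) → ℝ) : ℝ≥0∞ :=
  if γ ≤ 1 then (⨆ t ∈ Icc (0:ℝ) T, N (u t)) + hQuot γ T N u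
  else (⨆ t ∈ Icc (0:ℝ) T, N (u t)) + (⨆ t ∈ Icc (0:ℝ) T, N (tderiv T u t)) +
    hQuot (γ - 1) T N (tderiv T u)

/-- Membership in `C^γ([0,T];X)`, `X` described by the norm functional `N`. -/
def MemHolderFam {n : ℕ} (γ T : ℝ) (N : ((Fin n → ℝ) → ℝ) → ℝ≥0∞)
    (u : ℝ → (Fin n → ℝ) → ℝ) : Prop :=
  hNorm γ T N u ≠ ⊤ ∧
  (1 < γ → ∀ x : Fin n → ℝ, ∀ t ∈ Icc (0:ℝ) T,
    DifferentiableWithinAt ℝ (fun τ => u τ x) (Icc 0 T) t)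

/-- `f ∈ C¹(ℝ; Z)` where the space `Z` of space-time functions carries the norm `M`:
there is a `w`-derivative `fw` which is bounded and continuous in `w` for the norm `M`. -/
def MemC1inW {n : ℕ} (M : (ℝ → (Fin n → ℝ) → ℝ) → ℝ≥0∞)
    (f : ℝ → ℝ → (Fin n → ℝ) → ℝ) : Prop :=
  ∃ fw : ℝ → ℝ → (Fin n → ℝ) → ℝ,
    (∀ w t x, HasDerivAt (fun v => f v t x) (fw w t x) w) ∧
    (∀ w, M (fw w) ≠ ⊤) ∧
    (∀ w₀, Tendsto (fun w => M (fun t x => fw w t x - fw w₀ t x)) (𝓝 w₀) (𝓝 0))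

/-- The class `ℱ̆_γ = C(ℝ; C^γ([0,T];L_∞(Ω))) ∩ C¹(ℝ; L_∞((0,T)×Ω))`. -/
def MemFbreve {n : ℕ} (γ T : ℝ) (Ω : Set (Fin n → ℝ))
    (f : ℝ → ℝ → (Fin n → ℝ) → ℝ) : Prop :=
  (∀ w, MemHolderFam γ T (nLinf Ω) (f w)) ∧
  (∀ w₀, Tendsto (fun w => hNorm γ T (nLinf Ω) (fun t x => f w t x - f w₀ t x))
    (𝓝 w₀) (𝓝 0)) ∧
  MemC1inW (nLinfTX T Ω) f

/-- The class
`ℱ_{γ,δ} = C(ℝ; C^γ([0,T];C^δ(Ω̄))) ∩ C¹(ℝ; C^γ([0,T];L_∞(Ω)) ∩ L_∞((0,T);C^δ(Ω̄)))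
∩ C²(ℝ; L_∞((0,T)×Ω))`. -/
def MemF {n : ℕ} (γ δ T : ℝ) (Ω : Set (Fin n → ℝ))
    (f : ℝ → ℝ → (Fin n → ℝ) → ℝ) : Prop :=
  (∀ w, MemHolderFam γ T (nC δ Ω) (f w)) ∧
  (∀ w₀, Tendsto (fun w => hNorm γ T (nC δ Ω) (fun t x => f w t x - f w₀ t x))
    (𝓝 w₀) (𝓝 0)) ∧
  (∃ fw : ℝ → ℝ → (Fin n → ℝ) → ℝ,
    (∀ w t x, HasDerivAt (fun v => f v t x) (fw w t x) w) ∧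
    (∀ w, MemHolderFam γ T (nLinf Ω) (fw w)) ∧
    (∀ w₀, Tendsto (fun w => hNorm γ T (nLinf Ω) (fun t x => fw w t x - fw w₀ t x))
      (𝓝 w₀) (𝓝 0)) ∧
    (∀ w, nLinfC δ T Ω (fw w) ≠ ⊤) ∧
    (∀ w₀, Tendsto (fun w => nLinfC δ T Ω (fun t x => fw w t x - fw w₀ t x))
      (𝓝 w₀) (𝓝 0)) ∧
    MemC1inW (nLinfTX T Ω) fw)

lemma second_deriv_nonneg {E : Type*} [NormedAddCommGroup E] [NormedSpace ℝ E]
    {f : E → ℝ} {x : E} {f'' : E →L[ℝ] E →L[ℝ] ℝ}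
    (hd : ∀ᶠ y in 𝓝 x, DifferentiableAt ℝ f y) (h2 : HasFDerivAt (fderiv ℝ f) f'' x)
    (hmin : IsLocalMin f x) (ξ : E) : 0 ≤ f'' ξ ξ := by
  set γ : ℝ → E := fun s => x + s • ξ with hγ
  have hγd : ∀ s, HasDerivAt γ ξ s := fun s => by
    have := ((hasDerivAt_id s).smul_const ξ).const_add x
    rw [one_smul] at this
    exact this
  have hγ0 : γ 0 = x := by simp [hγ]
  have hγc : Tendsto γ (𝓝 0) (𝓝 x) := by
    have := (hγd 0).continuousAt
    rwa [ContinuousAt, hγ0] at this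
  have hg1 : ∀ᶠ s in 𝓝 (0:ℝ), HasDerivAt (fun s => f (γ s)) (fderiv ℝ f (γ s) ξ) s := by
    filter_upwards [hγc.eventually hd] with s hs
    exact hs.hasFDerivAt.comp_hasDerivAt s (hγd s)
  have hgd : deriv (fun s => f (γ s)) =ᶠ[𝓝 0] fun s => fderiv ℝ f (γ s) ξ := by
    filter_upwards [hg1] with s hs using hs.deriv
  have h2' : HasDerivAt (fun s => fderiv ℝ f (γ s) ξ) (f'' ξ ξ) 0 := by
    have h3 : HasFDerivAt (fderiv ℝ f) f'' (γ 0) := by rwa [hγ0]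
    have := h3.comp_hasDerivAt 0 (hγd 0)
    simpa using this.clm_apply (hasDerivAt_const (0:ℝ) ξ)
  have hdd : deriv (deriv (fun s => f (γ s))) 0 = f'' ξ ξ := by
    rw [hgd.deriv_eq, h2'.deriv]
  have hmin' : IsLocalMin (fun s => f (γ s)) 0 := by
    have := hγc.eventually hmin
    filter_upwards [this] with s hs
    simpa [hγ0] using hs
  by_contra hneg
  push Not at hneg
  have hmax := isLocalMax_of_deriv_deriv_neg (f := fun s => f (γ s)) (x₀ := 0)
    (by rw [hdd]; exact hneg) hmin'.deriv_eq_zero hg1.self_of_nhds.continuousAt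
  have hconst : (fun s => f (γ s)) =ᶠ[𝓝 0] fun _ => f (γ 0) := by
    filter_upwards [hmin', hmax] with s h1 h2 using le_antisymm h2 h1
  have : deriv (deriv (fun s => f (γ s))) 0 = 0 := by
    rw [hconst.deriv.deriv_eq]; simp
  rw [hdd] at this
  exact hneg.ne this

lemma clm_sum {n : ℕ} {F : Type*} [NormedAddCommGroup F] [NormedSpace ℝ F]
    (l : (Fin n → ℝ) →L[ℝ] F) (ξ : Fin n → ℝ) :
    l ξ = ∑ i, ξ i • l (Pi.single i 1) := by
  have : ξ = ∑ i, ξ i • (Pi.single i (1:ℝ) : Fin n → ℝ) := by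
    ext k; simp [Finset.sum_apply, Pi.single_apply]
  conv_lhs => rw [this]
  simp

lemma ell_nonneg {n : ℕ} {aC : Fin n → Fin n → (Fin n → ℝ) → ℝ}
    {bC : Fin n → (Fin n → ℝ) → ℝ} {Ω : Set (Fin n → ℝ)} (hΩ : IsOpen Ω)
    (hell : IsElliptic aC Ω) {f : (Fin n → ℝ) → ℝ} {x : Fin n → ℝ} (hx : x ∈ Ω)
    (h1 : ∀ y ∈ Ω, DifferentiableAt ℝ f y) (h2 : ∀ j, DifferentiableAt ℝ (pd j f) x)
    (hmin : IsLocalMin f x) : 0 ≤ ellOp aC bC f x := by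
  have hd : ∀ᶠ y in 𝓝 x, DifferentiableAt ℝ f y :=
    Filter.eventually_of_mem (hΩ.mem_nhds hx) h1
  have hrep : fderiv ℝ f = fun y => ∑ j, pd j f y •
      (ContinuousLinearMap.proj (R := ℝ) (φ := fun _ : Fin n => ℝ) j) := by
    funext y
    ext ξ
    rw [clm_sum (fderiv ℝ f y)]
    simp [pd, mul_comm]
  have hdd : DifferentiableAt ℝ (fderiv ℝ f) x := by
    rw [hrep]
    exact DifferentiableAt.fun_sum fun j _ => (h2 j).smul_const _
  obtain ⟨f'', hf''⟩ : ∃ f'', HasFDerivAt (fderiv ℝ f) f'' x := ⟨_, hdd.hasFDerivAt⟩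
  have hpd : ∀ i j, pd i (pd j f) x = f'' (Pi.single i 1) (Pi.single j 1) := by
    intro i j
    have : HasFDerivAt (pd j f) (f''.flip (Pi.single j 1)) x := by
      have := hf''.clm_apply (hasFDerivAt_const (Pi.single j (1:ℝ) : Fin n → ℝ) x)
      simp only [ContinuousLinearMap.comp_zero, zero_add] at this
      exact this
    rw [pd, this.fderiv]
    rfl
  have hsymm : ∀ v w, f'' v w = f'' w v :=
    second_derivative_symmetric_of_eventually (hd.mono fun y hy => hy.hasFDerivAt) hf''
  let H : Matrix (Fin n) (Fin n) ℝ := fun i j => f'' (Pi.single i 1) (Pi.single j 1)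
  have hH : H.PosSemidef := by
    apply Matrix.PosSemidef.of_dotProduct_mulVec_nonneg
    · ext i j
      exact hsymm (Pi.single j 1) (Pi.single i 1)
    · intro ξ
      have h0 := second_deriv_nonneg hd hf'' hmin ξ
      have : f'' ξ ξ = star ξ ⬝ᵥ H.mulVec ξ := by
        rw [clm_sum f'' ξ]
        simp only [sum_apply, dotProduct, Matrix.mulVec, star_trivial]
        refine Finset.sum_congr rfl fun i _ => ?_
        rw [smul_apply, clm_sum _ ξ, smul_eq_mul]
        congr 1
        refine Finset.sum_congr rfl fun j _ => ?_
        simp [H, mul_comm]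
      rwa [this] at h0
  obtain ⟨B, hB⟩ : ∃ B : Matrix (Fin n) (Fin n) ℝ, H = B.conjTranspose * B := by
    open scoped MatrixOrder Matrix.Norms.L2Operator in
    exact CStarAlgebra.nonneg_iff_eq_star_mul_self.mp hH.nonneg
  have hgrad : ∀ j, pd j f x = 0 := by
    intro j
    rw [pd, hmin.fderiv_eq_zero]; rfl
  obtain ⟨c, hc, hE⟩ := hell
  unfold ellOp
  simp only [hgrad, mul_zero, Finset.sum_const_zero, add_zero]
  have : ∑ i, ∑ j, aC i j x * pd i (pd j f) x
      = ∑ k, ∑ i, ∑ j, aC i j x * B k i * B k j := by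
    have h3 : ∀ i j, pd i (pd j f) x = ∑ k, B k i * B k j := by
      intro i j
      rw [hpd i j]
      change H i j = _
      rw [hB, Matrix.mul_apply]
      simp [Matrix.conjTranspose_apply]
    simp_rw [h3, Finset.mul_sum]
    rw [Finset.sum_comm' (t' := Finset.univ) (s' := fun _ => Finset.univ) (by simp)]
    rw [Finset.sum_comm]
    conv_rhs => rw [Finset.sum_comm]
    refine Finset.sum_congr rfl fun i _ => ?_
    rw [Finset.sum_comm]
    refine Finset.sum_congr rfl fun j _ => ?_
    refine Finset.sum_congr rfl fun k _ => ?_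
    ring
  rw [this]
  refine Finset.sum_nonneg fun k _ => ?_
  refine le_trans ?_ (hE x hx (B k))
  exact mul_nonneg hc.le (Finset.sum_nonneg fun i _ => sq_nonneg _)

/-- Extension of `f` from `[0,T]` to the line by constants. -/
noncomputable def extC (T : ℝ) (f : ℝ → ℝ) (s : ℝ) : ℝ := f (max 0 (min s T))

/-- Extension of the derivative by zero. -/
noncomputable def extD (T : ℝ) (v : ℝ → ℝ) : ℝ → ℝ := indicator (Ioc 0 T) v

lemma extC_of_mem {T : ℝ} {f : ℝ → ℝ} {s : ℝ} (hs : s ∈ Icc 0 T) : extC T f s = f s := by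
  rw [extC, min_eq_left hs.2, max_eq_right hs.1]

lemma extC_of_nonpos {T : ℝ} {f : ℝ → ℝ} {s : ℝ} (hs : s ≤ 0) : extC T f s = f 0 := by
  rw [extC, max_eq_left ((min_le_left _ _).trans hs)]

lemma extD_of_mem {T : ℝ} {f : ℝ → ℝ} {s : ℝ} (hs : s ∈ Ioc 0 T) : extD T f s = f s :=
  indicator_of_mem hs f

lemma extD_of_nonpos {T : ℝ} {f : ℝ → ℝ} {s : ℝ} (hs : s ≤ 0) : extD T f s = 0 :=
  indicator_of_notMem (fun h => absurd h.1 (not_lt.2 hs)) f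

lemma extC_left_deriv {T : ℝ} {f v : ℝ → ℝ}
    (hfv : ∀ t ∈ Icc (0:ℝ) T, HasDerivWithinAt f (v t) (Icc 0 T) t) {s : ℝ} (hs : s ≤ T) :
    HasDerivWithinAt (extC T f) (extD T v s) (Iio s) s := by
  rcases le_or_gt s 0 with h0 | h0
  · rw [extD_of_nonpos h0]
    exact (hasDerivWithinAt_const s (Iio s) (f 0)).congr
      (fun y hy => extC_of_nonpos (le_of_lt (lt_of_lt_of_le hy h0))) (extC_of_nonpos h0)
  · rw [extD_of_mem ⟨h0, hs⟩]
    have h1 : HasDerivWithinAt (extC T f) (v s) (Icc 0 T) s :=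
      (hfv s ⟨h0.le, hs⟩).congr (fun y hy => extC_of_mem hy) (extC_of_mem ⟨h0.le, hs⟩)
    refine h1.mono_of_mem_nhdsWithin ?_
    filter_upwards [Ioo_mem_nhdsLT h0] with y hy using ⟨hy.1.le, hy.2.le.trans hs⟩

lemma extC_deriv {T : ℝ} {f v : ℝ → ℝ}
    (hfv : ∀ t ∈ Icc (0:ℝ) T, HasDerivWithinAt f (v t) (Icc 0 T) t) {s : ℝ} (hs : s < T)
    (hs0 : s ≠ 0) : HasDerivAt (extC T f) (extD T v s) s := by
  rcases lt_or_gt_of_ne hs0 with h0 | h0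
  · rw [extD_of_nonpos h0.le]
    refine (hasDerivAt_const s (f 0)).congr_of_eventuallyEq ?_
    filter_upwards [Iio_mem_nhds h0] with y hy using extC_of_nonpos (le_of_lt hy)
  · rw [extD_of_mem ⟨h0, hs.le⟩]
    refine ((hfv s ⟨h0.le, hs.le⟩).hasDerivAt (Icc_mem_nhds h0 hs)).congr_of_eventuallyEq ?_
    filter_upwards [Icc_mem_nhds h0 hs] with y hy using extC_of_mem hy

lemma extC_lip {T L : ℝ} (hT : 0 < T) {f v : ℝ → ℝ}
    (hfv : ∀ t ∈ Icc (0:ℝ) T, HasDerivWithinAt f (v t) (Icc 0 T) t)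
    (hL : ∀ t ∈ Icc (0:ℝ) T, |v t| ≤ L) (s r : ℝ) :
    |extC T f s - extC T f r| ≤ L * |s - r| := by
  have hmem : ∀ s : ℝ, max 0 (min s T) ∈ Icc 0 T := fun s =>
    ⟨le_max_left _ _, max_le hT.le (min_le_right _ _)⟩
  have hL0 : 0 ≤ L := (abs_nonneg _).trans (hL 0 ⟨le_rfl, hT.le⟩)
  have h := Convex.norm_image_sub_le_of_norm_hasDerivWithin_le hfv
    (fun x hx => hL x hx) (convex_Icc 0 T) (hmem r) (hmem s)
  refine h.trans (mul_le_mul_of_nonneg_left ?_ hL0)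
  rw [Real.norm_eq_abs]
  rw [max_comm 0, max_comm 0]
  refine (abs_max_sub_max_le_abs _ _ _).trans ?_
  refine (abs_min_sub_min_le_max s T r T).trans ?_
  simp

lemma extD_meas {T : ℝ} {v : ℝ → ℝ} (hvc : ContinuousOn v (Icc 0 T)) :
    Measurable (extD T v) := by
  have h2 : Measurable (indicator (Ioc 0 T) (fun s => extC T v s)) := by
    refine Measurable.indicator ?_ measurableSet_Ioc
    refine Continuous.measurable ?_
    rcases le_or_gt 0 T with hT | hT
    · refine hvc.comp_continuous (by fun_prop) fun s => ?_
      exact ⟨le_max_left _ _, max_le hT (min_le_right _ _)⟩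
    · have : extC T v = fun _ => v 0 := by
        funext s
        rw [extC, max_eq_left ((min_le_right _ _).trans hT.le)]
      rw [this]; exact continuous_const
  have h3 : extD T v = indicator (Ioc 0 T) (fun s => extC T v s) := by
    refine indicator_congr fun s hs => ?_
    rw [extC_of_mem ⟨hs.1.le, hs.2⟩]
  rwa [h3]

lemma extD_bdd {T L : ℝ} (hT : 0 < T) {v : ℝ → ℝ} (hL : ∀ t ∈ Icc (0:ℝ) T, |v t| ≤ L) (s : ℝ) :
    |extD T v s| ≤ L := by
  have hL0 : 0 ≤ L := (abs_nonneg _).trans (hL 0 ⟨le_rfl, hT.le⟩)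
  by_cases h : s ∈ Ioc 0 T
  · rw [extD_of_mem h]; exact hL s ⟨h.1.le, h.2⟩
  · rw [extD, indicator_of_notMem h]; simpa

lemma ker_int {β a b : ℝ} (hβ : β ∈ Ioo (0:ℝ) 1) {W : ℝ → ℝ} (hW : Measurable W) {C : ℝ}
    (hC : ∀ s, |W s| ≤ C) :
    IntervalIntegrable (fun σ : ℝ => σ ^ (-β) * W σ) volume a b := by
  have h := intervalIntegral.intervalIntegrable_rpow' (a := a) (b := b) (r := -β)
    (by linarith [hβ.2])
  rw [intervalIntegrable_iff] at h ⊢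
  have := h.bdd_mul (c := C) hW.aestronglyMeasurable (Eventually.of_forall hC)
  simp only [mul_comm _ (W _)]
  exact this

lemma RLD_formula {β T L : ℝ} (hT : 0 < T) (hβ : β ∈ Ioo (0:ℝ) 1) {f v : ℝ → ℝ}
    (hfv : ∀ t ∈ Icc (0:ℝ) T, HasDerivWithinAt f (v t) (Icc 0 T) t)
    (hvc : ContinuousOn v (Icc 0 T)) (hL : ∀ t ∈ Icc (0:ℝ) T, |v t| ≤ L)
    {t : ℝ} (ht : t ∈ Ioo 0 T) :
    RLD β T (fun τ => f τ - f 0) t =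
      (Real.Gamma (1 - β))⁻¹ * ∫ σ in (0:ℝ)..T, σ ^ (-β) * extD T v (t - σ) := by
  have hL0 : 0 ≤ L := (abs_nonneg _).trans (hL 0 ⟨le_rfl, hT.le⟩)
  have hlip := extC_lip hT hfv hL
  have hcont : Continuous (extC T f) := by
    have : LipschitzWith (Real.toNNReal L) (extC T f) := by
      refine LipschitzWith.of_dist_le_mul fun s r => ?_
      rw [Real.dist_eq, Real.dist_eq, Real.coe_toNNReal _ hL0]
      exact hlip s r
    exact this.continuous
  have hker := intervalIntegral.intervalIntegrable_rpow' (a := 0) (b := T) (r := -β)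
    (by linarith [hβ.2])
  have key : HasDerivAt (fun s => ∫ σ in (0:ℝ)..T, σ ^ (-β) * (extC T f (s - σ) - f 0))
      (∫ σ in (0:ℝ)..T, σ ^ (-β) * extD T v (t - σ)) t := by
    refine (intervalIntegral.hasDerivAt_integral_of_dominated_loc_of_lip
      (bound := fun σ => σ ^ (-β) * L) (s := univ) univ_mem ?_ ?_ ?_ ?_ ?_ ?_).2
    · refine Eventually.of_forall fun s => ?_
      refine Measurable.aestronglyMeasurable ?_
      have := hcont.measurable
      fun_prop
    · exact hker.mul_continuousOn (by fun_prop)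
    · refine Measurable.aestronglyMeasurable ?_
      have := extD_meas hvc
      fun_prop
    · refine Eventually.of_forall fun σ hσ => ?_
      rw [uIoc_of_le hT.le] at hσ
      have hp : 0 ≤ σ ^ (-β) := Real.rpow_nonneg hσ.1.le _
      refine LipschitzOnWith.of_dist_le_mul fun s _ r _ => ?_
      rw [Real.dist_eq, Real.dist_eq, Real.coe_nnabs, abs_of_nonneg (mul_nonneg hp hL0),
        ← mul_sub, abs_mul, abs_of_nonneg hp, mul_assoc]
      refine mul_le_mul_of_nonneg_left ?_ hp
      have := hlip (s - σ) (r - σ)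
      simpa using this
    · exact hker.mul_const L
    · have : ∀ᵐ σ : ℝ, σ ≠ t := by simp [ae_iff, measure_singleton]
      filter_upwards [this] with σ hne hσ
      rw [uIoc_of_le hT.le] at hσ
      refine HasDerivAt.const_mul _ ?_
      refine HasDerivAt.sub_const _ ?_
      have h1 := extC_deriv hfv (s := t - σ) (by linarith [ht.2, hσ.1])
        (sub_ne_zero.2 hne.symm)
      exact HasDerivAt.comp_sub_const t σ h1
  have heq : ∀ s ∈ Icc 0 T, (∫ τ in (0:ℝ)..s, (s - τ) ^ (-β) * (f τ - f 0)) =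
      ∫ σ in (0:ℝ)..T, σ ^ (-β) * (extC T f (s - σ) - f 0) := by
    intro s hs
    have hint : ∀ a b, IntervalIntegrable
        (fun σ : ℝ => σ ^ (-β) * (extC T f (s - σ) - f 0)) volume a b := fun a b =>
      (intervalIntegral.intervalIntegrable_rpow' (by linarith [hβ.2])).mul_continuousOn
        (by fun_prop)
    rw [← intervalIntegral.integral_add_adjacent_intervals (hint 0 s) (hint s T)]
    have h2 : ∫ σ in s..T, σ ^ (-β) * (extC T f (s - σ) - f 0) = 0 := by
      refine intervalIntegral.integral_zero_ae (Eventually.of_forall fun σ hσ => ?_)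
      rw [uIoc_of_le hs.2] at hσ
      rw [extC_of_nonpos (by linarith [hσ.1])]; simp
    rw [h2, add_zero]
    have h3 := intervalIntegral.integral_comp_sub_left (a := 0) (b := s)
      (fun σ : ℝ => σ ^ (-β) * (extC T f (s - σ) - f 0)) s
    simp only [sub_self, sub_zero] at h3
    rw [← h3]
    refine intervalIntegral.integral_congr fun τ hτ => ?_
    rw [uIcc_of_le hs.1] at hτ
    rw [show s - (s - τ) = τ by ring, extC_of_mem ⟨hτ.1, hτ.2.trans hs.2⟩]
  unfold RLD
  have h4 : HasDerivWithinAt (fun s => (Real.Gamma (1 - β))⁻¹ *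
      ∫ τ in (0:ℝ)..s, (s - τ) ^ (-β) * (f τ - f 0))
      ((Real.Gamma (1 - β))⁻¹ * ∫ σ in (0:ℝ)..T, σ ^ (-β) * extD T v (t - σ)) (Icc 0 T) t := by
    refine (key.hasDerivWithinAt.const_mul _).congr (fun s hs => ?_) ?_
    · rw [heq s hs]
    · rw [heq t ⟨ht.1.le, ht.2.le⟩]
  exact h4.derivWithin (uniqueDiffOn_Icc hT t ⟨ht.1.le, ht.2.le⟩)

lemma bracket_bound {β t lam : ℝ} (hβ : β ∈ Ioo (0:ℝ) 1) (ht : 0 < t) (hl : 0 < lam) :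
    (1 - Real.exp (-1)) * lam ^ β ≤ t ^ (-β) * Real.exp (-(lam * t)) +
      ∫ σ in (0:ℝ)..t, σ ^ (-β) * (lam * Real.exp (-(lam * σ))) := by
  have hint : ∀ a b, IntervalIntegrable
      (fun σ : ℝ => σ ^ (-β) * (lam * Real.exp (-(lam * σ)))) volume a b := fun a b =>
    (intervalIntegral.intervalIntegrable_rpow' (by linarith [hβ.2])).mul_continuousOn
      (by fun_prop)
  have hexp : ∀ m : ℝ, ∫ σ in (0:ℝ)..m, lam * Real.exp (-(lam * σ)) =
      1 - Real.exp (-(lam * m)) := by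
    intro m
    have hd : ∀ x ∈ uIcc 0 m, HasDerivAt (fun σ => - Real.exp (-(lam * σ)))
        (lam * Real.exp (-(lam * x))) x := by
      intro x _
      have := (((hasDerivAt_id x).const_mul lam).fun_neg.exp).fun_neg
      simp only [id] at this
      exact this.congr_deriv (by ring)
    rw [intervalIntegral.integral_eq_sub_of_hasDerivAt hd
      (Continuous.intervalIntegrable (by fun_prop) _ _)]
    simp; ring
  have hsub : ∀ m, 0 < m → ∀ k, (k ≤ m ^ (-β)) → k * (1 - Real.exp (-(lam * m))) ≤
      ∫ σ in (0:ℝ)..m, σ ^ (-β) * (lam * Real.exp (-(lam * σ))) := by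
    intro m hm k hk
    rw [← hexp, ← intervalIntegral.integral_const_mul]
    refine intervalIntegral.integral_mono_on_of_le_Ioo hm.le
      (Continuous.intervalIntegrable (by fun_prop) _ _) (hint _ _) fun σ hσ => ?_
    refine mul_le_mul_of_nonneg_right (hk.trans ?_) (by positivity)
    exact Real.rpow_le_rpow_of_nonpos hσ.1 hσ.2.le (by linarith [hβ.1])
  have he1 : (0:ℝ) < Real.exp (-1) := Real.exp_pos _
  have hlp : 0 < lam ^ β := Real.rpow_pos_of_pos hl _
  have hinv : (lam⁻¹) ^ (-β) = lam ^ β := by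
    rw [Real.inv_rpow hl.le, Real.rpow_neg hl.le, inv_inv]
  rcases le_or_gt t lam⁻¹ with h | h
  · have h1 : lam ^ β ≤ t ^ (-β) := by
      rw [← hinv]
      exact Real.rpow_le_rpow_of_nonpos ht h (by linarith [hβ.1])
    have h2 := hsub t ht _ h1
    have h3 := mul_le_mul_of_nonneg_right h1 (Real.exp_pos (-(lam * t))).le
    nlinarith
  · have h2 := hsub lam⁻¹ (inv_pos.2 hl) _ hinv.ge
    rw [mul_inv_cancel₀ hl.ne'] at h2
    rw [← intervalIntegral.integral_add_adjacent_intervals (hint 0 lam⁻¹) (hint lam⁻¹ t)]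
    have h3 : 0 ≤ ∫ σ in lam⁻¹..t, σ ^ (-β) * (lam * Real.exp (-(lam * σ))) := by
      refine intervalIntegral.integral_nonneg h.le fun σ hσ => ?_
      have : 0 ≤ σ := (inv_pos.2 hl).le.trans hσ.1
      positivity
    have h4 : 0 ≤ t ^ (-β) * Real.exp (-(lam * t)) := by positivity
    linarith

lemma one_d {β T L : ℝ} (hT : 0 < T) (hβ : β ∈ Ioo (0:ℝ) 1) {f v : ℝ → ℝ}
    (hfv : ∀ t ∈ Icc (0:ℝ) T, HasDerivWithinAt f (v t) (Icc 0 T) t)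
    (hvc : ContinuousOn v (Icc 0 T)) (hL : ∀ t ∈ Icc (0:ℝ) T, |v t| ≤ L)
    {t h lam : ℝ} (ht : t ∈ Ioc 0 T) (hh : 0 < h) (hl : 0 < lam) {Δ : ℝ → ℝ}
    (hΔ : Δ = fun s => extC T f s - extC T f (s - h))
    (hneg : Δ t ≤ 0)
    (hmin : ∀ s ∈ Icc 0 t, Real.exp (-(lam * (t - s))) * Δ t ≤ Δ s) :
    (∫ σ in (0:ℝ)..T, σ ^ (-β) * extD T v (t - σ)) -
      (∫ σ in (0:ℝ)..T, σ ^ (-β) * extD T v (t - h - σ)) ≤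
      (1 - Real.exp (-1)) * lam ^ β * Δ t := by
  have hL0 : 0 ≤ L := (abs_nonneg _).trans (hL 0 ⟨le_rfl, hT.le⟩)
  have hlip := extC_lip hT hfv hL
  have hm := extD_meas hvc
  have hb := extD_bdd hT hL
  set W : ℝ → ℝ := fun σ => extD T v (t - σ) - extD T v (t - h - σ) with hW
  have hWm : Measurable W := by fun_prop
  have hWb : ∀ s, |W s| ≤ L + L := fun s => (abs_sub _ _).trans (add_le_add (hb _) (hb _))
  have hWint : ∀ a b, IntervalIntegrable (fun σ : ℝ => σ ^ (-β) * W σ) volume a b :=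
    fun a b => ker_int hβ hWm hWb
  have hEint : ∀ a b, IntervalIntegrable
      (fun σ : ℝ => σ ^ (-β) * (lam * Real.exp (-(lam * σ)))) volume a b := fun a b =>
    (intervalIntegral.intervalIntegrable_rpow' (by linarith [hβ.2])).mul_continuousOn
      (by fun_prop)
  have e1 : (∫ σ in (0:ℝ)..T, σ ^ (-β) * extD T v (t - σ)) -
      (∫ σ in (0:ℝ)..T, σ ^ (-β) * extD T v (t - h - σ)) = ∫ σ in (0:ℝ)..t, σ ^ (-β) * W σ := by
    rw [← intervalIntegral.integral_sub
      (ker_int hβ (by fun_prop) (fun s => hb _)) (ker_int hβ (by fun_prop) (fun s => hb _))]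
    have : ∀ σ : ℝ, σ ^ (-β) * extD T v (t - σ) - σ ^ (-β) * extD T v (t - h - σ)
        = σ ^ (-β) * W σ := fun σ => by rw [hW]; ring
    simp_rw [this]
    rw [← intervalIntegral.integral_add_adjacent_intervals (hWint 0 t) (hWint t T)]
    have h2 : ∫ σ in t..T, σ ^ (-β) * W σ = 0 := by
      refine intervalIntegral.integral_zero_ae (Eventually.of_forall fun σ hσ => ?_)
      rw [uIoc_of_le ht.2] at hσ
      rw [hW]
      simp only
      rw [extD_of_nonpos (by linarith [hσ.1]), extD_of_nonpos (by linarith [hσ.1])]; simp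
    rw [h2, add_zero]
  rw [e1]
  set V := Δ t with hV
  set d : ℝ → ℝ := fun σ => Real.exp (-(lam * σ)) * V - Δ (t - σ) with hd
  have hΔlip : ∀ s r, |Δ s - Δ r| ≤ (L + L) * |s - r| := by
    intro s r
    have h1 := hlip s r
    have h2 := hlip (s - h) (r - h)
    rw [show s - h - (r - h) = s - r by ring] at h2
    rw [hΔ]
    calc _ = |(extC T f s - extC T f r) - (extC T f (s - h) - extC T f (r - h))| := by
          congr 1; ring
      _ ≤ _ := (abs_sub _ _).trans (by linarith)
  have hΔc : Continuous Δ := by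
    have : LipschitzWith (Real.toNNReal (L + L)) Δ := by
      refine LipschitzWith.of_dist_le_mul fun s r => ?_
      rw [Real.dist_eq, Real.dist_eq, Real.coe_toNNReal _ (by linarith)]
      exact hΔlip s r
    exact this.continuous
  have hΔ0 : Δ 0 = 0 := by
    rw [hΔ]
    simp only
    rw [extC_of_nonpos le_rfl, extC_of_nonpos (by linarith)]; simp
  have hdc : Continuous d := by fun_prop
  have hd0 : d 0 = 0 := by simp [hd, hV]
  have hdneg : ∀ σ ∈ Icc 0 t, d σ ≤ 0 := by
    intro σ hσ
    have := hmin (t - σ) ⟨by linarith [hσ.2], by linarith [hσ.1]⟩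
    rw [_root_.sub_sub_cancel] at this
    simp only [hd]; linarith
  have hdb : ∀ σ ∈ Icc 0 t, |d σ| ≤ (lam * |V| + (L + L)) * σ := by
    intro σ hσ
    have h1 : d σ = (Real.exp (-(lam * σ)) - 1) * V + (Δ t - Δ (t - σ)) := by
      simp only [hd, hV]; ring
    have h2 := hΔlip t (t - σ)
    rw [_root_.sub_sub_cancel, abs_of_nonneg hσ.1] at h2
    have h3 : |Real.exp (-(lam * σ)) - 1| ≤ lam * σ := by
      have ha := Real.add_one_le_exp (-(lam * σ))
      have hb : Real.exp (-(lam * σ)) ≤ 1 :=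
        Real.exp_le_one_iff.2 (by have := mul_nonneg hl.le hσ.1; linarith)
      rw [abs_le]; constructor <;> linarith [mul_nonneg hl.le hσ.1]
    rw [h1]
    refine (abs_add_le _ _).trans ?_
    rw [abs_mul]
    have := mul_le_mul_of_nonneg_right h3 (abs_nonneg V)
    nlinarith
  have hgc : ContinuousOn (fun σ : ℝ => σ ^ (-β) * d σ) (Icc 0 t) := by
    intro σ hσ
    rcases eq_or_lt_of_le hσ.1 with h0 | h0
    · subst h0
      rw [ContinuousWithinAt, hd0, mul_zero]
      have hlim : Tendsto (fun σ : ℝ => (lam * |V| + (L + L)) * σ ^ (1 - β)) (𝓝[Icc 0 t] 0)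
          (𝓝 0) := by
        have : ContinuousAt (fun σ : ℝ => (lam * |V| + (L + L)) * σ ^ (1 - β)) 0 := by
          refine ContinuousAt.mul continuousAt_const ?_
          exact Real.continuousAt_rpow_const _ _ (Or.inr (by linarith [hβ.2]))
        have h2 := this.tendsto
        rw [Real.zero_rpow (by linarith [hβ.2]), mul_zero] at h2
        exact h2.mono_left nhdsWithin_le_nhds
      refine squeeze_zero_norm' ?_ hlim
      filter_upwards [self_mem_nhdsWithin] with s hs
      rw [Real.norm_eq_abs, abs_mul, abs_of_nonneg (Real.rpow_nonneg hs.1 _)]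
      rcases eq_or_lt_of_le hs.1 with h1 | h1
      · have h9 : (1:ℝ) - β ≠ 0 := by linarith [hβ.2]
        rw [← h1, hd0, Real.zero_rpow h9]; simp
      · have := mul_le_mul_of_nonneg_left (hdb s hs) (Real.rpow_nonneg hs.1 (-β))
        refine this.trans_eq ?_
        rw [sub_eq_neg_add, Real.rpow_add_one h1.ne']; ring
    · refine ContinuousAt.continuousWithinAt ?_
      exact (Real.continuousAt_rpow_const _ _ (Or.inl h0.ne')).mul hdc.continuousAt
  have hder : ∀ σ ∈ Ioo 0 t, HasDerivWithinAt (fun σ : ℝ => σ ^ (-β) * d σ)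
      ((-β * σ ^ (-β - 1)) * d σ + σ ^ (-β) * (W σ - lam * Real.exp (-(lam * σ)) * V))
      (Ioi σ) σ := by
    intro σ hσ
    have h1 : HasDerivWithinAt (fun σ : ℝ => σ ^ (-β)) (-β * σ ^ (-β - 1)) (Ioi σ) σ :=
      (Real.hasDerivAt_rpow_const (Or.inl hσ.1.ne')).hasDerivWithinAt
    refine h1.mul ?_
    have h2 : ∀ c : ℝ, c ≤ t → HasDerivWithinAt (fun σ => extC T f (c - σ))
        (- extD T v (c - σ)) (Ioi σ) σ := by
      intro c hc
      have h3 := extC_left_deriv hfv (s := c - σ) (by linarith [hσ.1, ht.2])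
      have h4 : HasDerivWithinAt (fun σ : ℝ => c - σ) (-1) (Ioi σ) σ := by
        simpa using ((hasDerivAt_id σ).const_sub c).hasDerivWithinAt
      have h5 := h3.scomp σ h4 (fun y hy => by simpa using hy)
      simpa [Function.comp_def] using h5
    have hE : HasDerivWithinAt (fun σ : ℝ => Real.exp (-(lam * σ)) * V)
        (- (lam * Real.exp (-(lam * σ)) * V)) (Ioi σ) σ := by
      have := (((hasDerivAt_id σ).const_mul lam).fun_neg.exp).mul_const V
      simp only [id] at this
      exact (this.congr_deriv (by ring)).hasDerivWithinAt
    have h6 := hE.fun_sub ((h2 t le_rfl).fun_sub (h2 (t - h) (by linarith)))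
    have h7 : d = fun σ => Real.exp (-(lam * σ)) * V -
        (extC T f (t - σ) - extC T f (t - h - σ)) := by
      funext r
      simp only [hd, hΔ]
      rw [show t - r - h = t - h - r by ring]
    rw [h7]
    exact h6.congr_deriv (by simp only [hW]; ring)
  have hφint : ∀ a b, IntervalIntegrable (fun σ : ℝ => σ ^ (-β) * W σ -
      V * (σ ^ (-β) * (lam * Real.exp (-(lam * σ))))) volume a b := fun a b =>
    (hWint a b).sub ((hEint a b).const_mul V)
  have main := intervalIntegral.integral_le_sub_of_hasDeriv_right_of_le ht.1.le hgc hder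
    (φ := fun σ : ℝ => σ ^ (-β) * W σ - V * (σ ^ (-β) * (lam * Real.exp (-(lam * σ)))))
    ((intervalIntegrable_iff_integrableOn_Icc_of_le ht.1.le).1 (hφint 0 t)) (by
      intro σ hσ
      have h1 := hdneg σ ⟨hσ.1.le, hσ.2.le⟩
      have h2 : 0 ≤ β * σ ^ (-β - 1) := mul_nonneg hβ.1.le (Real.rpow_nonneg hσ.1.le _)
      nlinarith [mul_nonneg h2 (neg_nonneg.2 h1)])
  rw [intervalIntegral.integral_sub (hWint 0 t) ((hEint 0 t).const_mul V),
    intervalIntegral.integral_const_mul] at main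
  simp only [hd0, mul_zero, sub_zero] at main
  have hdt : d t = Real.exp (-(lam * t)) * V := by
    simp only [hd, sub_self, hΔ0, sub_zero]
  rw [hdt] at main
  have hB := bracket_bound hβ ht.1 hl
  have := mul_le_mul_of_nonpos_right hB hneg
  linarith

lemma holder_bdd {n : ℕ} {γ T : ℝ} (hγ1 : γ ≤ 1) {Ω : Set (Fin n → ℝ)}
    {v : ℝ → (Fin n → ℝ) → ℝ} (hv : MemHolderFam γ T (nC0 Ω) v) :
    ∃ L, 0 ≤ L ∧ ∀ t ∈ Icc (0:ℝ) T, ∀ x ∈ closure Ω, |v t x| ≤ L := by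
  have h := hv.1
  rw [hNorm, if_pos hγ1] at h
  have h1 := (ENNReal.add_ne_top.1 h).1
  refine ⟨(⨆ t ∈ Icc (0:ℝ) T, nC0 Ω (v t)).toReal, ENNReal.toReal_nonneg, fun t ht x hx => ?_⟩
  rw [← ENNReal.ofReal_le_iff_le_toReal h1]
  refine le_trans ?_ (le_iSup₂ (f := fun t (_ : t ∈ Icc (0:ℝ) T) => nC0 Ω (v t)) t ht)
  exact le_iSup₂ (f := fun x (_ : x ∈ closure Ω) => ENNReal.ofReal |v t x|) x hx

lemma holder_cont {n : ℕ} {γ T : ℝ} (hγ : 0 < γ) (hγ1 : γ ≤ 1) {Ω : Set (Fin n → ℝ)}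
    {v : ℝ → (Fin n → ℝ) → ℝ} (hv : MemHolderFam γ T (nC0 Ω) v) {x : Fin n → ℝ}
    (hx : x ∈ closure Ω) : ContinuousOn (fun t => v t x) (Icc 0 T) := by
  have h := hv.1
  rw [hNorm, if_pos hγ1] at h
  have h1 := (ENNReal.add_ne_top.1 h).2
  have key : ∀ s ∈ Icc (0:ℝ) T, ∀ t ∈ Icc (0:ℝ) T,
      |v t x - v s x| ≤ (hQuot γ T (nC0 Ω) v).toReal * |t - s| ^ γ := by
    intro s hs t ht
    rcases eq_or_ne t s with rfl | hne
    · simp [Real.zero_rpow hγ.ne']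
    have hpos : 0 < |t - s| ^ γ := Real.rpow_pos_of_pos (abs_pos.2 (sub_ne_zero.2 hne)) _
    have h2 : nC0 Ω (fun x => v t x - v s x) / ENNReal.ofReal (|t - s| ^ γ)
        ≤ hQuot γ T (nC0 Ω) v := by
      unfold hQuot
      refine le_trans ?_ (le_iSup₂ s hs)
      exact le_iSup₂ (f := fun t (_ : t ∈ Icc (0:ℝ) T) =>
        nC0 Ω (fun x => v t x - v s x) / ENNReal.ofReal (|t - s| ^ γ)) t ht
    rw [ENNReal.div_le_iff (by simpa using hpos) ENNReal.ofReal_ne_top] at h2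
    have h3 : ENNReal.ofReal |v t x - v s x| ≤ nC0 Ω (fun x => v t x - v s x) :=
      le_iSup₂ (f := fun x (_ : x ∈ closure Ω) => ENNReal.ofReal |v t x - v s x|) x hx
    have h4 := h3.trans h2
    rw [ENNReal.ofReal_le_iff_le_toReal (ENNReal.mul_ne_top h1 ENNReal.ofReal_ne_top),
      ENNReal.toReal_mul, ENNReal.toReal_ofReal hpos.le] at h4
    exact h4
  intro s hs
  rw [ContinuousWithinAt, tendsto_iff_norm_sub_tendsto_zero]
  have hlim : Tendsto (fun t : ℝ => (hQuot γ T (nC0 Ω) v).toReal * |t - s| ^ γ)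
      (𝓝[Icc 0 T] s) (𝓝 0) := by
    have : Continuous (fun t : ℝ => (hQuot γ T (nC0 Ω) v).toReal * |t - s| ^ γ) := by
      refine continuous_const.mul ?_
      exact Continuous.rpow_const (by fun_prop) (fun _ => Or.inr hγ.le)
    have h2 := this.tendsto s
    rw [sub_self, abs_zero, Real.zero_rpow hγ.ne', mul_zero] at h2
    exact h2.mono_left nhdsWithin_le_nhds
  refine squeeze_zero' (Eventually.of_forall fun _ => norm_nonneg _) ?_ hlim
  filter_upwards [self_mem_nhdsWithin] with t ht using key s hs t ht

lemma pd_sub {n : ℕ} {f g : (Fin n → ℝ) → ℝ} {x : Fin n → ℝ} (hf : DifferentiableAt ℝ f x)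
    (hg : DifferentiableAt ℝ g x) (j : Fin n) :
    pd j (fun y => f y - g y) x = pd j f x - pd j g x := by
  rw [pd, fderiv_fun_sub hf hg]; rfl

lemma pd_congr {n : ℕ} {f g : (Fin n → ℝ) → ℝ} {x : Fin n → ℝ} (h : f =ᶠ[𝓝 x] g) (j : Fin n) :
    pd j f x = pd j g x := by
  rw [pd, h.fderiv_eq]; rfl

lemma pd_sub_ev {n : ℕ} {Ω : Set (Fin n → ℝ)} (hΩ : IsOpen Ω) {f g : (Fin n → ℝ) → ℝ}
    {x : Fin n → ℝ} (hx : x ∈ Ω) (hf : ∀ y ∈ Ω, DifferentiableAt ℝ f y)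
    (hg : ∀ y ∈ Ω, DifferentiableAt ℝ g y) (j : Fin n) :
    pd j (fun y => f y - g y) =ᶠ[𝓝 x] fun y => pd j f y - pd j g y := by
  filter_upwards [hΩ.mem_nhds hx] with y hy using pd_sub (hf y hy) (hg y hy) j

lemma ellOp_congr {n : ℕ} (aC : Fin n → Fin n → (Fin n → ℝ) → ℝ)
    (bC : Fin n → (Fin n → ℝ) → ℝ) {f g : (Fin n → ℝ) → ℝ} {x : Fin n → ℝ}
    (h : f =ᶠ[𝓝 x] g) : ellOp aC bC f x = ellOp aC bC g x := by
  have h1 : ∀ j, pd j f =ᶠ[𝓝 x] pd j g := fun j =>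
    h.eventuallyEq_nhds.mono fun y hy => pd_congr hy j
  simp only [ellOp, fun j => pd_congr h j, fun i j => pd_congr (h1 j) i]

lemma ellOp_sub {n : ℕ} (aC : Fin n → Fin n → (Fin n → ℝ) → ℝ)
    (bC : Fin n → (Fin n → ℝ) → ℝ) {Ω : Set (Fin n → ℝ)} (hΩ : IsOpen Ω)
    {f g : (Fin n → ℝ) → ℝ}
    {x : Fin n → ℝ} (hx : x ∈ Ω) (hf : ∀ y ∈ Ω, DifferentiableAt ℝ f y)
    (hg : ∀ y ∈ Ω, DifferentiableAt ℝ g y) (hf2 : ∀ j, DifferentiableAt ℝ (pd j f) x)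
    (hg2 : ∀ j, DifferentiableAt ℝ (pd j g) x) :
    ellOp aC bC (fun y => f y - g y) x = ellOp aC bC f x - ellOp aC bC g x := by
  have h1 : ∀ i j, pd i (pd j (fun y => f y - g y)) x = pd i (pd j f) x - pd i (pd j g) x := by
    intro i j
    rw [pd_congr (pd_sub_ev hΩ hx hf hg j) i, pd_sub (hf2 j) (hg2 j)]
  simp only [ellOp, h1, fun j => pd_sub (hf x hx) (hg x hx) j, mul_sub, Finset.sum_sub_distrib]
  ring

lemma core {n : ℕ} {T β L : ℝ} (hT : 0 < T) (hβ : β ∈ Ioo (0:ℝ) 1) (hL0 : 0 ≤ L)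
    {Ω : Set (Fin n → ℝ)} (hΩo : IsOpen Ω) (hΩb : Bornology.IsBounded Ω)
    {aC : Fin n → Fin n → (Fin n → ℝ) → ℝ} {bC : Fin n → (Fin n → ℝ) → ℝ}
    (hell : IsElliptic aC Ω)
    {F Fw Ft : ℝ → ℝ → (Fin n → ℝ) → ℝ}
    (hFw : ∀ w t x, HasDerivAt (fun v => F v t x) (Fw w t x) w)
    (hFt : ∀ w x, ∀ t ∈ Icc (0:ℝ) T,
      HasDerivWithinAt (fun τ => F w τ x) (Ft w t x) (Icc 0 T) t)
    (hFwc : ContinuousOn (fun p : ℝ × ℝ × (Fin n → ℝ) => Fw p.1 p.2.1 p.2.2)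
      ((univ : Set ℝ) ×ˢ (Icc 0 T ×ˢ closure Ω)))
    (hFtc : ContinuousOn (fun p : ℝ × ℝ × (Fin n → ℝ) => Ft p.1 p.2.1 p.2.2)
      ((univ : Set ℝ) ×ˢ (Icc 0 T ×ˢ closure Ω)))
    {u v : ℝ → (Fin n → ℝ) → ℝ}
    (hu : ContinuousOn (fun p : ℝ × (Fin n → ℝ) => u p.1 p.2) (Icc 0 T ×ˢ closure Ω))
    (hudiffx : ∀ t ∈ Icc (0:ℝ) T, ∀ x ∈ Ω,
      DifferentiableAt ℝ (u t) x ∧ ∀ j, DifferentiableAt ℝ (pd j (u t)) x)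
    (hfv : ∀ x ∈ closure Ω, ∀ t ∈ Icc (0:ℝ) T,
      HasDerivWithinAt (fun τ => u τ x) (v t x) (Icc 0 T) t)
    (hvc : ∀ x ∈ closure Ω, ContinuousOn (fun t => v t x) (Icc 0 T))
    (hL : ∀ x ∈ closure Ω, ∀ t ∈ Icc (0:ℝ) T, |v t x| ≤ L)
    (heq : ∀ t ∈ Ico (0:ℝ) T, ∀ x ∈ Ω,
      (Real.Gamma (1 - β))⁻¹ * (∫ σ in (0:ℝ)..T, σ ^ (-β) * extD T (fun t => v t x) (t - σ)) =
        ellOp aC bC (u t) x + F (u t x) t x)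
    (hcone : ∀ t ∈ Ioo (0:ℝ) T, ∀ x ∈ Ω, 0 ≤ Ft (u t x) t x)
    (hbd : ∀ x ∈ frontier Ω, MonotoneOn (fun t => u t x) (Icc 0 T)) :
    ∀ t ∈ Ioo (0:ℝ) T, ∀ x ∈ closure Ω, 0 ≤ v t x := by
  have hΩc : IsCompact (closure Ω) := hΩb.isCompact_closure
  have hcomp : IsCompact (Icc 0 T ×ˢ closure Ω) := isCompact_Icc.prod hΩc
  obtain ⟨R, hR⟩ := hcomp.exists_bound_of_continuousOn hu
  have hR' : ∀ t ∈ Icc (0:ℝ) T, ∀ x ∈ closure Ω, u t x ∈ Icc (-R) R := fun t ht x hx =>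
    abs_le.1 (hR (t, x) ⟨ht, hx⟩)
  set K : Set (ℝ × ℝ × (Fin n → ℝ)) := Icc (-R) R ×ˢ (Icc 0 T ×ˢ closure Ω) with hK
  have hKc : IsCompact K := isCompact_Icc.prod hcomp
  have hKsub : K ⊆ (univ : Set ℝ) ×ˢ (Icc 0 T ×ˢ closure Ω) :=
    prod_mono (subset_univ _) subset_rfl
  obtain ⟨M₀, hM₀⟩ := hKc.exists_bound_of_continuousOn (hFwc.mono hKsub)
  set M := max M₀ 0 with hM
  have hM0 : 0 ≤ M := le_max_right _ _
  have hMb : ∀ w ∈ Icc (-R) R, ∀ t ∈ Icc (0:ℝ) T, ∀ x ∈ closure Ω, ‖Fw w t x‖ ≤ M :=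
    fun w hw t ht x hx => (hM₀ (w, t, x) ⟨hw, ht, hx⟩).trans (le_max_left _ _)
  have hΓ : 0 < Real.Gamma (1 - β) := Real.Gamma_pos_of_pos (by linarith [hβ.2])
  have he : 0 < 1 - Real.exp (-1) := by
    have : Real.exp (-1) < 1 := by simpa using Real.exp_lt_exp.2 (show (-1:ℝ) < 0 by norm_num)
    linarith
  set q : ℝ := (M + 1) * Real.Gamma (1 - β) / (1 - Real.exp (-1)) with hq
  have hqpos : 0 < q := by positivity
  set lam : ℝ := q ^ (β⁻¹) with hlam
  have hlpos : 0 < lam := Real.rpow_pos_of_pos hqpos _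
  have hlb : lam ^ β = q := Real.rpow_inv_rpow hqpos.le hβ.1.ne'
  have hKK : (Real.Gamma (1 - β))⁻¹ * ((1 - Real.exp (-1)) * lam ^ β) = M + 1 := by
    rw [hlb, hq]; field_simp
  have hu_lip : ∀ x ∈ closure Ω, ∀ s ∈ Icc (0:ℝ) T, ∀ t ∈ Icc (0:ℝ) T,
      |u t x - u s x| ≤ L * |t - s| := fun x hx s hs t ht =>
    Convex.norm_image_sub_le_of_norm_hasDerivWithin_le (hfv x hx) (hL x hx)
      (convex_Icc 0 T) hs ht
  -- the quantitative step
  have step : ∀ T' ∈ Ioo (0:ℝ) T, ∀ ε > 0, ∃ h₀ > 0, ∀ h ∈ Ioo (0:ℝ) h₀,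
      ∀ t ∈ Icc (0:ℝ) T', ∀ x ∈ closure Ω,
        -(ε * h * Real.exp (lam * T)) ≤ u t x - u (max 0 (min (t - h) T)) x := by
    intro T' hT' ε hε
    have huc := hKc.uniformContinuousOn_of_continuous (hFtc.mono hKsub)
    rw [Metric.uniformContinuousOn_iff] at huc
    obtain ⟨δ, hδ, huc⟩ := huc ε hε
    refine ⟨δ / (L + 1), by positivity, fun h hh => ?_⟩
    have hLh : L * h < δ := by
      have := (lt_div_iff₀ (by linarith : 0 < L + 1)).1 hh.2
      nlinarith [hh.1]
    set p : ℝ → ℝ := fun t => max 0 (min (t - h) T) with hp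
    have hpmem : ∀ t, p t ∈ Icc 0 T := fun t =>
      ⟨le_max_left _ _, max_le hT.le (min_le_right _ _)⟩
    have hple : ∀ t, 0 ≤ t → p t ≤ t := fun t ht =>
      max_le ht ((min_le_left _ _).trans (by linarith [hh.1]))
    have hpge : ∀ t ≤ T, t - p t ≤ h := fun t ht => by
      have : t - h ≤ p t := le_max_of_le_right (le_min le_rfl (by linarith [hh.1]))
      linarith
    have hT'sub : Icc 0 T' ⊆ Icc 0 T := Icc_subset_Icc le_rfl hT'.2.le
    have hGc : ContinuousOn (fun y : ℝ × (Fin n → ℝ) =>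
        Real.exp (-(lam * y.1)) * (u y.1 y.2 - u (p y.1) y.2)) (Icc 0 T' ×ˢ closure Ω) := by
      refine ContinuousOn.mul (by fun_prop) (ContinuousOn.sub ?_ ?_)
      · exact hu.mono (prod_mono hT'sub subset_rfl)
      · have : ContinuousOn (fun y : ℝ × (Fin n → ℝ) => (p y.1, y.2)) (Icc 0 T' ×ˢ closure Ω) := by
          simp only [hp]; fun_prop
        exact hu.comp this fun y hy => ⟨hpmem _, hy.2⟩
    intro t ht x hx
    obtain ⟨⟨t₀, x₀⟩, ⟨ht₀, hx₀⟩, hmin⟩ := (isCompact_Icc.prod hΩc).exists_isMinOn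
      ⟨(t, x), ht, hx⟩ hGc
    simp only at ht₀ hx₀
    have hmin' : ∀ s ∈ Icc 0 T', ∀ y ∈ closure Ω,
        Real.exp (-(lam * t₀)) * (u t₀ x₀ - u (p t₀) x₀) ≤
          Real.exp (-(lam * s)) * (u s y - u (p s) y) := fun s hs y hy =>
      hmin (show (s, y) ∈ Icc 0 T' ×ˢ closure Ω from ⟨hs, hy⟩)
    have claim : -(ε * h) ≤ u t₀ x₀ - u (p t₀) x₀ := by
      by_contra hcon
      push Not at hcon
      have hεh : 0 < ε * h := mul_pos hε hh.1
      have ht₀T : t₀ ∈ Icc 0 T := hT'sub ht₀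
      have hne : u t₀ x₀ - u (p t₀) x₀ < 0 := by linarith
      have ht₀pos : 0 < t₀ := by
        rcases eq_or_lt_of_le ht₀.1 with h0 | h0
        · have : p t₀ = t₀ := by
            refine le_antisymm (hple _ ht₀.1) ?_
            rw [← h0]; exact (hpmem _).1
          rw [this] at hne; linarith
        · exact h0
      have ht₀lt : t₀ < T := ht₀.2.trans_lt hT'.2
      have hx₀Ω : x₀ ∈ Ω := by
        by_contra hnot
        have hfr : x₀ ∈ frontier Ω := by
          rw [hΩo.frontier_eq]; exact ⟨hx₀, hnot⟩
        have := hbd x₀ hfr (hpmem t₀) ht₀T (hple _ ht₀.1)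
        simp only at this
        linarith
      have hplt : p t₀ ∈ Ico 0 T := ⟨(hpmem _).1, (hple _ ht₀.1).trans_lt ht₀lt⟩
      -- the fractional derivative
      have hfrac := one_d hT hβ (hfv x₀ hx₀) (hvc x₀ hx₀) (hL x₀ hx₀)
        (t := t₀) (h := h) (lam := lam) ⟨ht₀pos, ht₀T.2⟩ hh.1 hlpos rfl
        (by
          rw [extC_of_mem ht₀T]
          exact hne.le)
        (by
          intro s hs
          have hsT' : s ∈ Icc 0 T' := ⟨hs.1, hs.2.trans ht₀.2⟩
          rw [extC_of_mem ht₀T, extC_of_mem (hT'sub hsT')]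
          have h1 := mul_le_mul_of_nonneg_left (hmin' s hsT' x₀ hx₀)
            (Real.exp_pos (lam * s)).le
          rw [← mul_assoc, ← mul_assoc, ← Real.exp_add, ← Real.exp_add, add_neg_cancel,
            Real.exp_zero, one_mul] at h1
          rw [show -(lam * (t₀ - s)) = lam * s + -(lam * t₀) by ring]
          exact h1)
      rw [extC_of_mem ht₀T] at hfrac
      have hJ : (∫ σ in (0:ℝ)..T, σ ^ (-β) * extD T (fun t => v t x₀) (t₀ - h - σ)) =
          ∫ σ in (0:ℝ)..T, σ ^ (-β) * extD T (fun t => v t x₀) (p t₀ - σ) := by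
        rcases le_or_gt 0 (t₀ - h) with h0 | h0
        · have : p t₀ = t₀ - h := by
            simp only [hp]
            rw [min_eq_left (by linarith [hh.1]), max_eq_right h0]
          rw [this]
        · have : p t₀ = 0 := by
            simp only [hp]
            exact max_eq_left ((min_le_left _ _).trans h0.le)
          rw [this]
          refine intervalIntegral.integral_congr fun σ hσ => ?_
          rw [uIcc_of_le hT.le] at hσ
          beta_reduce
          rw [extD_of_nonpos (by linarith [hσ.1]), extD_of_nonpos (by linarith [hσ.1])]
      rw [hJ] at hfrac
      have hfrac2 := mul_le_mul_of_nonneg_left hfrac (inv_pos.2 hΓ).le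
      rw [mul_sub, heq t₀ ⟨ht₀.1, ht₀lt⟩ x₀ hx₀Ω, heq (p t₀) hplt x₀ hx₀Ω, ← mul_assoc, hKK]
        at hfrac2
      change _ ≤ (M + 1) * (u t₀ x₀ - u (p t₀) x₀) at hfrac2
      -- the elliptic part
      have hf1 : ∀ y ∈ Ω, DifferentiableAt ℝ (u t₀) y := fun y hy => (hudiffx t₀ ht₀T y hy).1
      have hg1 : ∀ y ∈ Ω, DifferentiableAt ℝ (u (p t₀)) y := fun y hy =>
        (hudiffx _ (hpmem t₀) y hy).1
      have hf2 := (hudiffx t₀ ht₀T x₀ hx₀Ω).2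
      have hg2 := (hudiffx _ (hpmem t₀) x₀ hx₀Ω).2
      have hlm : IsLocalMin (fun y => u t₀ y - u (p t₀) y) x₀ := by
        filter_upwards [hΩo.mem_nhds hx₀Ω] with y hy
        exact le_of_mul_le_mul_left (hmin' t₀ ht₀ y (subset_closure hy)) (Real.exp_pos _)
      have hE := ell_nonneg (bC := bC) hΩo hell hx₀Ω
        (fun y hy => (hf1 y hy).sub (hg1 y hy))
        (fun j => ((hf2 j).sub (hg2 j)).congr_of_eventuallyEq
          (pd_sub_ev hΩo hx₀Ω hf1 hg1 j)) hlm
      have hE2 := ellOp_sub aC bC hΩo hx₀Ω hf1 hg1 hf2 hg2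
      change ellOp aC bC (u t₀ - u (p t₀)) x₀ = _ at hE2
      rw [hE2] at hE
      -- the nonlinearity
      have hN1 : |F (u t₀ x₀) t₀ x₀ - F (u (p t₀) x₀) t₀ x₀| ≤ M * |u t₀ x₀ - u (p t₀) x₀| :=
        Convex.norm_image_sub_le_of_norm_hasDerivWithin_le
          (f := fun w => F w t₀ x₀) (s := Icc (-R) R)
          (fun w _ => (hFw w t₀ x₀).hasDerivWithinAt)
          (fun w hw => hMb w hw t₀ ht₀T x₀ hx₀) (convex_Icc _ _)
          (hR' _ (hpmem t₀) x₀ hx₀) (hR' _ ht₀T x₀ hx₀)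
      rw [abs_of_neg hne] at hN1
      have hN1' := (abs_le.1 hN1).1
      have hN2 : F (u (p t₀) x₀) (p t₀) x₀ + ε * p t₀ ≤ F (u (p t₀) x₀) t₀ x₀ + ε * t₀ := by
        have hsub : Icc (p t₀) t₀ ⊆ Icc 0 T := Icc_subset_Icc (hpmem _).1 ht₀T.2
        have hder : ∀ τ ∈ Ioo (p t₀) t₀, HasDerivAt (fun τ => F (u (p t₀) x₀) τ x₀ + ε * τ)
            (Ft (u (p t₀) x₀) τ x₀ + ε) τ := by
          intro τ hτ
          have hτ0 : 0 < τ := (hpmem t₀).1.trans_lt hτ.1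
          have hτT : τ < T := hτ.2.trans ht₀lt
          have h1 := (hFt (u (p t₀) x₀) x₀ τ ⟨hτ0.le, hτT.le⟩).hasDerivAt
            (Icc_mem_nhds hτ0 hτT)
          have h2 := (hasDerivAt_id τ).const_mul ε
          rw [mul_one] at h2
          exact h1.add h2
        have hmono : MonotoneOn (fun τ => F (u (p t₀) x₀) τ x₀ + ε * τ) (Icc (p t₀) t₀) := by
          refine monotoneOn_of_deriv_nonneg (convex_Icc _ _) ?_ ?_ ?_
          · refine ContinuousOn.add ?_ (by fun_prop)
            intro τ hτ
            exact (hFt (u (p t₀) x₀) x₀ τ (hsub hτ)).continuousWithinAt.mono hsub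
          · rw [interior_Icc]
            exact fun τ hτ => (hder τ hτ).differentiableAt.differentiableWithinAt
          · rw [interior_Icc]
            intro τ hτ
            rw [(hder τ hτ).deriv]
            have hτ0 : 0 < τ := (hpmem t₀).1.trans_lt hτ.1
            have hτT : τ < T := hτ.2.trans ht₀lt
            have hτm : τ ∈ Icc 0 T := ⟨hτ0.le, hτT.le⟩
            have h1 := hcone τ ⟨hτ0, hτT⟩ x₀ hx₀Ω
            have h2 := hu_lip x₀ hx₀ _ (hpmem t₀) τ hτm
            have h3 : |τ - p t₀| ≤ h := by
              rw [abs_of_pos (by linarith [hτ.1])]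
              linarith [hpge t₀ ht₀T.2, hτ.2]
            have h4 : |u τ x₀ - u (p t₀) x₀| < δ :=
              (h2.trans (mul_le_mul_of_nonneg_left h3 hL0)).trans_lt hLh
            have h5 := huc (u τ x₀, τ, x₀) ⟨hR' τ hτm x₀ hx₀, hτm, hx₀⟩
              (u (p t₀) x₀, τ, x₀) ⟨hR' _ (hpmem t₀) x₀ hx₀, hτm, hx₀⟩ (by
                simp only [Prod.dist_eq, dist_self, Real.dist_eq]
                simp [hδ, h4])
            rw [Real.dist_eq] at h5
            have := (abs_lt.1 h5).2
            simp only at this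
            linarith
        exact hmono (left_mem_Icc.2 (hple _ ht₀.1)) (right_mem_Icc.2 (hple _ ht₀.1))
          (hple _ ht₀.1)
      have hN3 : ε * (t₀ - p t₀) ≤ ε * h := mul_le_mul_of_nonneg_left (hpge t₀ ht₀T.2) hε.le
      linarith
    have h1 := hmin' t ht x hx
    have h2 : -(ε * h) ≤ Real.exp (-(lam * t₀)) * (u t₀ x₀ - u (p t₀) x₀) := by
      have h3 : Real.exp (-(lam * t₀)) ≤ 1 :=
        Real.exp_le_one_iff.2 (by have := mul_nonneg hlpos.le ht₀.1; linarith)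
      have h4 := mul_le_mul_of_nonneg_left claim (Real.exp_pos (-(lam * t₀))).le
      have h5 := mul_pos hε hh.1
      nlinarith
    have h3 := mul_le_mul_of_nonneg_left (h2.trans h1) (Real.exp_pos (lam * t)).le
    rw [← mul_assoc, ← Real.exp_add, add_neg_cancel, Real.exp_zero, one_mul] at h3
    refine le_trans ?_ h3
    have h4 : Real.exp (lam * t) ≤ Real.exp (lam * T) :=
      Real.exp_le_exp.2 (mul_le_mul_of_nonneg_left (hT'sub ht).2 hlpos.le)
    have h5 := mul_pos hε hh.1
    nlinarith
  intro t ht x hx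
  have hbound : ∀ ε > 0, -(ε * Real.exp (lam * T)) ≤ v t x := by
    intro ε hε
    obtain ⟨h₀, hh₀, hstep⟩ := step t ht ε hε
    have hd : HasDerivWithinAt (fun τ => u τ x) (v t x) (Iio t) t :=
      ((hfv x hx t ⟨ht.1.le, ht.2.le⟩).hasDerivAt (Icc_mem_nhds ht.1 ht.2)).hasDerivWithinAt
    rw [hasDerivWithinAt_iff_tendsto_slope' (by simp)] at hd
    refine ge_of_tendsto hd ?_
    filter_upwards [Ioo_mem_nhdsLT (show max 0 (t - h₀) < t from
      max_lt ht.1 (by linarith))] with y hy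
    have hy0 : 0 < y := (le_max_left _ _).trans_lt hy.1
    have hy1 : t - h₀ < y := (le_max_right _ _).trans_lt hy.1
    have h1 := hstep (t - y) ⟨by linarith [hy.2], by linarith⟩ t ⟨ht.1.le, le_rfl⟩ x hx
    rw [show t - (t - y) = y by ring, min_eq_left (by linarith [hy.2, ht.2]),
      max_eq_right hy0.le] at h1
    have h2 : 0 < t - y := by linarith [hy.2]
    rw [slope_def_field, show (u y x - u t x) / (y - t) = (u t x - u y x) / (t - y) by
      rw [← neg_div_neg_eq, neg_sub, neg_sub], le_div_iff₀ h2]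
    linarith
  by_contra hneg
  push Not at hneg
  have hEp := Real.exp_pos (lam * T)
  have := hbound (-(v t x) / 2 / Real.exp (lam * T)) (by
    have : 0 < -(v t x) := by linarith
    positivity)
  rw [div_mul_cancel₀ _ hEp.ne'] at this
  linarith

/-- **Theorem 5 (first part): monotonicity of the solution in time, Dirichlet case.** -/
theorem solution_time_monotone {n : ℕ}
    (T β β' β'' : ℝ) (hT : 0 < T) (hβ : β ∈ Ioo (0:ℝ) 1)
    (hβ' : β < β') (hβ'1 : β' ≤ 1) (hβ'' : 1 - β < β'') (hβ''1 : β'' ≤ 1)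
    (Ω : Set (Fin n → ℝ)) (hΩo : IsOpen Ω) (hΩb : Bornology.IsBounded Ω)
    (aC : Fin n → Fin n → (Fin n → ℝ) → ℝ) (bC : Fin n → (Fin n → ℝ) → ℝ)
    (haC : ∀ i j, ContinuousOn (aC i j) (closure Ω))
    (hbC : ∀ j, ContinuousOn (bC j) (closure Ω))
    (hell : IsElliptic aC Ω)
    (z : (Fin n → ℝ) → ℝ) (hz : ContinuousOn z (closure Ω))
    (a b aw bw at' bt : ℝ → ℝ → (Fin n → ℝ) → ℝ)
    (hawd : ∀ w t x, HasDerivAt (fun v => a v t x) (aw w t x) w)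
    (hbwd : ∀ w t x, HasDerivAt (fun v => b v t x) (bw w t x) w)
    (hatd : ∀ w x, ∀ t ∈ Icc (0:ℝ) T,
      HasDerivWithinAt (fun τ => a w τ x) (at' w t x) (Icc 0 T) t)
    (hbtd : ∀ w x, ∀ t ∈ Icc (0:ℝ) T,
      HasDerivWithinAt (fun τ => b w τ x) (bt w t x) (Icc 0 T) t)
    (haH : ∀ w, MemHolderFam β'' T (nLinf Ω) (a w))
    (haHc : ∀ w₀, Tendsto (fun w => hNorm β'' T (nLinf Ω) (fun t x => a w t x - a w₀ t x))
      (𝓝 w₀) (𝓝 0))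
    (hbH : ∀ w, MemHolderFam β'' T (nLinf Ω) (b w))
    (hbHc : ∀ w₀, Tendsto (fun w => hNorm β'' T (nLinf Ω) (fun t x => b w t x - b w₀ t x))
      (𝓝 w₀) (𝓝 0))
    (hawc : ContinuousOn (fun p : ℝ × ℝ × (Fin n → ℝ) => aw p.1 p.2.1 p.2.2)
      ((univ : Set ℝ) ×ˢ (Icc 0 T ×ˢ closure Ω)))
    (hbwc : ContinuousOn (fun p : ℝ × ℝ × (Fin n → ℝ) => bw p.1 p.2.1 p.2.2)
      ((univ : Set ℝ) ×ˢ (Icc 0 T ×ˢ closure Ω)))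
    (hatc : ContinuousOn (fun p : ℝ × ℝ × (Fin n → ℝ) => at' p.1 p.2.1 p.2.2)
      ((univ : Set ℝ) ×ˢ (Icc 0 T ×ˢ closure Ω)))
    (hbtc : ContinuousOn (fun p : ℝ × ℝ × (Fin n → ℝ) => bt p.1 p.2.1 p.2.2)
      ((univ : Set ℝ) ×ˢ (Icc 0 T ×ˢ closure Ω)))
    (u : ℝ → (Fin n → ℝ) → ℝ) (u₀ : (Fin n → ℝ) → ℝ) (g : ℝ → (Fin n → ℝ) → ℝ)
    (hu : ContinuousOn (fun p : ℝ × (Fin n → ℝ) => u p.1 p.2) (Icc 0 T ×ˢ closure Ω))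
    (huL1 : MemHolderFam β'' T (nLp 1 Ω) u)
    (huxL1 : ∀ j, MemHolderFam β'' T (nLp 1 Ω) (fun t => pd j (u t)))
    (huxxL1 : ∀ i j, MemHolderFam β'' T (nLp 1 Ω) (fun t => pd i (pd j (u t))))
    (hudiffx : ∀ t ∈ Icc (0:ℝ) T, ∀ x ∈ Ω,
      DifferentiableAt ℝ (u t) x ∧ ∀ j, DifferentiableAt ℝ (pd j (u t)) x)
    (hutdiff : ∀ x ∈ closure Ω, ∀ t ∈ Icc (0:ℝ) T,
      DifferentiableWithinAt ℝ (fun τ => u τ x) (Icc 0 T) t)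
    (hut : MemHolderFam β' T (nC0 Ω) (tderiv T u))
    (hutc : ∀ t ∈ Icc (0:ℝ) T, ContinuousOn (tderiv T u t) (closure Ω))
    (hutx : ∀ j, ContinuousOn (fun p : ℝ × (Fin n → ℝ) => pd j (tderiv T u p.1) p.2)
      (Ioc 0 T ×ˢ closure Ω))
    (hutxx : ∀ i j,
      ContinuousOn (fun p : ℝ × (Fin n → ℝ) => pd i (pd j (tderiv T u p.1)) p.2)
      (Ioc 0 T ×ˢ closure Ω))
    (heq : ∀ t ∈ Ioo (0:ℝ) T, ∀ x ∈ Ω,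
      RLD β T (fun τ => u τ x - u₀ x) t =
        ellOp aC bC (u t) x + a (u t x) t x * z x + b (u t x) t x)
    (hinit : ∀ x ∈ Ω, u 0 x = u₀ x)
    (hbc : ∀ t ∈ Ioo (0:ℝ) T, ∀ x ∈ frontier Ω, u t x = g t x)
    (ha0 : ∀ x ∈ Ω, a (u₀ x) 0 x = 0)
    (hAb0 : ∀ x ∈ Ω, ellOp aC bC u₀ x + b (u₀ x) 0 x = 0)
    (hgdiff : ∀ x ∈ frontier Ω, ∀ t ∈ Icc (0:ℝ) T,
      DifferentiableWithinAt ℝ (fun τ => g τ x) (Icc 0 T) t)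
    (hgt : ∀ t ∈ Ioo (0:ℝ) T, ∀ x ∈ frontier Ω, 0 ≤ tderiv T g t x)
    (hcone : ∀ t ∈ Ioo (0:ℝ) T, ∀ x ∈ Ω,
      0 ≤ at' (u t x) t x * z x + bt (u t x) t x)
    :
    ∀ t ∈ Icc (0:ℝ) T, ∀ x ∈ closure Ω, 0 ≤ tderiv T u t x := by
  have hv0 : 0 < β' := hβ.1.trans hβ'
  obtain ⟨L, hL0, hL⟩ := holder_bdd hβ'1 hut
  have hvc : ∀ x ∈ closure Ω, ContinuousOn (fun t => tderiv T u t x) (Icc 0 T) :=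
    fun x hx => holder_cont hv0 hβ'1 hut hx
  have hfv : ∀ x ∈ closure Ω, ∀ t ∈ Icc (0:ℝ) T,
      HasDerivWithinAt (fun τ => u τ x) (tderiv T u t x) (Icc 0 T) t :=
    fun x hx t ht => (hutdiff x hx t ht).hasDerivWithinAt
  have hzc : ContinuousOn (fun p : ℝ × ℝ × (Fin n → ℝ) => z p.2.2)
      ((univ : Set ℝ) ×ˢ (Icc 0 T ×ˢ closure Ω)) :=
    hz.comp (by fun_prop) fun p hp => hp.2.2
  have main : ∀ t ∈ Ioo (0:ℝ) T, ∀ x ∈ closure Ω, 0 ≤ tderiv T u t x := by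
    refine core (F := fun w t x => a w t x * z x + b w t x)
      (Fw := fun w t x => aw w t x * z x + bw w t x)
      (Ft := fun w t x => at' w t x * z x + bt w t x) (u := u) (aC := aC) (bC := bC)
      hT hβ hL0 hΩo hΩb hell
      (fun w t x => ((hawd w t x).mul_const (z x)).add (hbwd w t x))
      (fun w x t ht => ((hatd w x t ht).mul_const (z x)).add (hbtd w x t ht))
      ((hawc.mul hzc).add hbwc) ((hatc.mul hzc).add hbtc) hu hudiffx hfv hvc
      (fun x hx t ht => hL t ht x hx) ?_ hcone ?_
    · intro t ht x hx
      rcases eq_or_lt_of_le ht.1 with h0 | h0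
      · subst h0
        have hI : (∫ σ in (0:ℝ)..T, σ ^ (-β) * extD T (fun t => tderiv T u t x) (0 - σ)) = 0 := by
          rw [intervalIntegral.integral_congr (g := fun _ => (0:ℝ))]
          · simp
          · intro σ hσ
            rw [uIcc_of_le hT.le] at hσ
            simp only
            rw [extD_of_nonpos (by linarith [hσ.1]), mul_zero]
        have hE : ellOp aC bC (u 0) x = ellOp aC bC u₀ x :=
          ellOp_congr aC bC (by
            filter_upwards [hΩo.mem_nhds hx] with y hy using hinit y hy)
        rw [hI, hE, hinit x hx, ha0 x hx, mul_zero, zero_mul, zero_add, hAb0 x hx]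
      · have h1 := RLD_formula hT hβ (hfv x (subset_closure hx)) (hvc x (subset_closure hx))
          (fun t ht => hL t ht x (subset_closure hx)) (t := t) ⟨h0, ht.2⟩
        rw [← h1]
        simp only [hinit x hx]
        rw [heq t ⟨h0, ht.2⟩ x hx, add_assoc]
    · intro x hx
      have hxc := frontier_subset_closure hx
      refine monotoneOn_of_deriv_nonneg (convex_Icc _ _)
        (fun t ht => (hfv x hxc t ht).continuousWithinAt) ?_ ?_
      · rw [interior_Icc]
        exact fun t ht => ((hfv x hxc t ⟨ht.1.le, ht.2.le⟩).hasDerivAt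
          (Icc_mem_nhds ht.1 ht.2)).differentiableAt.differentiableWithinAt
      · rw [interior_Icc]
        intro t ht
        have hev : (fun τ => u τ x) =ᶠ[𝓝 t] fun τ => g τ x := by
          filter_upwards [Ioo_mem_nhds ht.1 ht.2] with τ hτ using hbc τ hτ x hx
        rw [hev.deriv_eq]
        have h1 := hgt t ht x hx
        rw [tderiv, derivWithin_of_mem_nhds (Icc_mem_nhds ht.1 ht.2)] at h1
        exact h1
  intro t ht x hx
  have hcl : t ∈ closure (Ioo 0 T) := by rwa [closure_Ioo hT.ne]
  have hne : (𝓝[Ioo 0 T] t).NeBot := mem_closure_iff_nhdsWithin_neBot.1 hcl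
  refine ge_of_tendsto (((hvc x hx) t ht).mono_left (nhdsWithin_mono _ Ioo_subset_Icc_self)) ?_
  filter_upwards [self_mem_nhdsWithin] with s hs using main s hs x hx
end

section
/- Under the hypotheses of the monotonicity theorem (so that u solves D^β[u−u_0] = Au + a(u,t,x)z(x) + b(u,t,x) with the stated regularity and u_t ≥ 0), assume in addition that a(u(t,x),t,x) ≥ 0, a_w(u(t,x),t,x) ≥ 0 and a_t(u(t,x),t,x) ≥ 0 on (0,T)×Ω. Then Θ := sup{ θ : (D^β − θ) a(u(·,x),·,x)(t) ≥ 0 for all (t,x) ∈ (0,T)×Ω } ≥ T^{−β}/Γ(1−β). In fact, D^β[a(u(·,x),·,x)](t) ≥ (t^{−β}/Γ(1−β))·a(u(t,x),t,x) for all (t,x) ∈ (0,T]×Ω. -/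
open Set MeasureTheory Filter Topology ENNReal

theorem aux_kernel_int {β : ℝ} (hβ : β ∈ Ioo (0:ℝ) 1) (t a b : ℝ) :
    IntervalIntegrable (fun τ => (t - τ) ^ (-β)) volume a b := by
  have h := (intervalIntegral.intervalIntegrable_rpow' (a := t - a) (b := t - b)
    (r := -β) (by linarith [hβ.2])).comp_sub_left t
  simpa using h

theorem aux_kernel_val {β : ℝ} (hβ : β ∈ Ioo (0:ℝ) 1) (t a : ℝ) :
    ∫ τ in a..t, (t - τ) ^ (-β) = (t - a) ^ (1 - β) / (1 - β) := by
  have h := intervalIntegral.integral_comp_sub_left (a := a) (b := t)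
    (fun x : ℝ => x ^ (-β)) t
  rw [h, integral_rpow (Or.inl (by linarith [hβ.2]))]
  have : -β + 1 = 1 - β := by ring
  rw [this, sub_self, Real.zero_rpow (by linarith [hβ.2]), sub_zero]

theorem aux_shift {β : ℝ} (hβ : β ∈ Ioo (0:ℝ) 1) {T s : ℝ} (hs : s ∈ Icc 0 T) (G φ : ℝ → ℝ)
    (hneg : ∀ r < 0, G r = 0) (hpos : ∀ r ∈ Icc 0 T, G r = φ r)
    (hint : IntervalIntegrable (fun σ => σ ^ (-β) * G (s - σ)) volume 0 T) :
    ∫ σ in (0:ℝ)..T, σ ^ (-β) * G (s - σ) = ∫ τ in (0:ℝ)..s, (s - τ) ^ (-β) * φ τ := by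
  have hs0 := hs.1
  have hsT := hs.2
  have hi1 : IntervalIntegrable (fun σ => σ ^ (-β) * G (s - σ)) volume 0 s :=
    hint.mono_set (by rw [uIcc_of_le hs0, uIcc_of_le (hs0.trans hsT)]; exact Icc_subset_Icc_right hsT)
  have hi2 : IntervalIntegrable (fun σ => σ ^ (-β) * G (s - σ)) volume s T :=
    hint.mono_set (by rw [uIcc_of_le hsT, uIcc_of_le (hs0.trans hsT)]; exact Icc_subset_Icc_left hs0)
  rw [← intervalIntegral.integral_add_adjacent_intervals hi1 hi2]
  have h2 : ∫ σ in s..T, σ ^ (-β) * G (s - σ) = 0 := by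
    rw [intervalIntegral.integral_of_le hsT]
    rw [setIntegral_congr_fun (g := fun _ => (0:ℝ)) measurableSet_Ioc]
    · simp
    · intro σ hσ
      simp only
      rw [hneg _ (by linarith [hσ.1]), mul_zero]
  rw [h2, add_zero]
  have h3 := intervalIntegral.integral_comp_sub_left (a := 0) (b := s)
    (fun x : ℝ => (s - x) ^ (-β) * φ x) s
  simp only [sub_self, sub_zero] at h3
  rw [← h3]
  apply intervalIntegral.integral_congr
  intro σ hσ
  rw [uIcc_of_le hs0] at hσ
  simp only
  rw [hpos _ ⟨by linarith [hσ.2], by linarith [hσ.1]⟩, _root_.sub_sub_cancel]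

theorem aux_RL {β T : ℝ} (hT : 0 < T) (hβ : β ∈ Ioo (0:ℝ) 1) (f f' : ℝ → ℝ)
    (hf : ∀ t ∈ Icc (0:ℝ) T, HasDerivWithinAt f (f' t) (Icc 0 T) t)
    (hf' : ContinuousOn f' (Icc 0 T)) (h0 : f 0 = 0) {t : ℝ} (ht : t ∈ Ioc 0 T) :
    RLD β T f t = (Real.Gamma (1 - β))⁻¹ * ∫ τ in (0:ℝ)..t, (t - τ) ^ (-β) * f' τ := by
  have htI : t ∈ Icc 0 T := ⟨ht.1.le, ht.2⟩
  set e : ℝ → ℝ := IccExtend hT.le ((Icc 0 T).domRestrict f') with he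
  have hec : Continuous e := by
    exact hf'.domRestrict.Icc_extend'
  have hee : ∀ r ∈ Icc 0 T, e r = f' r := fun r hr => by
    rw [he, IccExtend_of_mem _ _ hr]; rfl
  obtain ⟨C, hC⟩ : ∃ C : ℝ, ∀ r ∈ Icc 0 T, ‖f' r‖ ≤ C :=
    isCompact_Icc.exists_bound_of_continuousOn hf'
  have hC0 : 0 ≤ C := (norm_nonneg _).trans (hC 0 ⟨le_rfl, hT.le⟩)
  have heC : ∀ r, ‖e r‖ ≤ C := by
    intro r
    rw [he, IccExtend_apply]
    exact hC _ (Subtype.mem _)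
  set g : ℝ → ℝ := (Ici (0:ℝ)).indicator e with hg
  have hgC : ∀ r, ‖g r‖ ≤ C := fun r => (norm_indicator_le_norm_self _ _).trans (heC r)
  have hgm : Measurable g := hec.measurable.indicator measurableSet_Ici
  have hgi : ∀ a b, IntervalIntegrable g volume a b := by
    intro a b
    rw [intervalIntegrable_iff]
    exact Measure.integrableOn_of_bounded (M := C) (by simp) hgm.aestronglyMeasurable
      (Eventually.of_forall hgC)
  set F : ℝ → ℝ := fun s => ∫ τ in (0:ℝ)..s, g τ with hF
  have hFlip : ∀ a b, ‖F a - F b‖ ≤ C * |a - b| := by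
    intro a b
    have : F a - F b = ∫ τ in b..a, g τ :=
      intervalIntegral.integral_interval_sub_left (hgi _ _) (hgi _ _)
    rw [this]
    exact intervalIntegral.norm_integral_le_of_norm_le_const (fun x _ => hgC x)
  have hFL : LipschitzWith (Real.nnabs C) F := by
    apply LipschitzWith.of_dist_le_mul
    intro a b
    rw [dist_eq_norm, Real.dist_eq]
    simpa [abs_of_nonneg hC0] using hFlip a b
  have hFd : ∀ r, r ≠ 0 → HasDerivAt F (g r) r := by
    intro r hr
    apply intervalIntegral.integral_hasDerivAt_right (hgi _ _)
      hgm.stronglyMeasurable.stronglyMeasurableAtFilter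
    rcases lt_or_gt_of_ne hr with h | h
    · have : g =ᶠ[𝓝 r] fun _ => 0 := by
        filter_upwards [Iio_mem_nhds h] with y hy
        simp [hg, not_le.mpr (mem_Iio.mp hy)]
      exact continuousAt_const.congr this.symm
    · have : g =ᶠ[𝓝 r] e := by
        filter_upwards [Ioi_mem_nhds h] with y hy
        simp [hg, (mem_Ioi.mp hy).le]
      exact hec.continuousAt.congr this.symm
  have hgneg : ∀ r < 0, g r = 0 := fun r hr => by simp [hg, not_le.mpr hr]
  have hgpos : ∀ r ∈ Icc 0 T, g r = f' r := fun r hr => by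
    rw [← hee r hr]; simp [hg, hr.1]
  have hFneg : ∀ r < 0, F r = 0 := by
    intro r hr
    rw [hF]
    simp only
    rw [intervalIntegral.integral_symm, intervalIntegral.integral_of_le hr.le,
      integral_Ioc_eq_integral_Ioo,
      setIntegral_congr_fun (g := fun _ => (0:ℝ)) measurableSet_Ioo]
    · simp
    · intro σ hσ
      exact hgneg σ hσ.2
  have hFpos : ∀ r ∈ Icc 0 T, F r = f r := by
    intro r hr
    have := intervalIntegral.integral_eq_sub_of_hasDeriv_right_of_le hr.1 (f := f) (f' := g)
      (fun y hy => ((hf y ⟨hy.1, hy.2.trans hr.2⟩).continuousWithinAt).mono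
        (Icc_subset_Icc_right hr.2))
      (fun y hy => by
        rw [hgpos y ⟨hy.1.le, hy.2.le.trans hr.2⟩]
        have := (hf y ⟨hy.1.le, hy.2.le.trans hr.2⟩)
        exact (this.hasDerivAt (Icc_mem_nhds hy.1 (hy.2.trans_le hr.2))).hasDerivWithinAt)
      (hgi _ _)
    rw [hF]; simp only; rw [this, h0, sub_zero]
  have hk : IntervalIntegrable (fun σ : ℝ => σ ^ (-β)) volume 0 T :=
    intervalIntegral.intervalIntegrable_rpow' (by linarith [hβ.2])
  have hFi : ∀ s, IntervalIntegrable (fun σ => σ ^ (-β) * F (s - σ)) volume 0 T := by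
    intro s
    apply hk.mul_continuousOn
    exact (hFL.continuous.comp (continuous_const.sub continuous_id)).continuousOn
  have key := intervalIntegral.hasDerivAt_integral_of_dominated_loc_of_lip
    (μ := volume) (a := 0) (b := T) (F := fun s σ => σ ^ (-β) * F (s - σ))
    (F' := fun σ => σ ^ (-β) * g (t - σ)) (x₀ := t) (s := univ) (bound := fun σ => σ ^ (-β) * C)
    univ_mem
    (Eventually.of_forall fun s => (intervalIntegrable_iff.mp (hFi s)).aestronglyMeasurable)
    (hFi t)
    (by
      apply AEStronglyMeasurable.mul
      · exact (intervalIntegrable_iff.mp hk).aestronglyMeasurable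
      · exact (hgm.comp (measurable_const.sub measurable_id)).aestronglyMeasurable)
    (by
      refine Eventually.of_forall fun σ _ => ?_
      apply LipschitzWith.lipschitzOnWith
      apply LipschitzWith.of_dist_le_mul
      intro a b
      have := hFlip (a - σ) (b - σ)
      rw [dist_eq_norm, Real.dist_eq]
      rw [← mul_sub, norm_mul]
      simp only [Real.coe_nnabs, abs_mul, abs_of_nonneg hC0, Real.norm_eq_abs] at this ⊢
      rw [mul_assoc]
      apply mul_le_mul_of_nonneg_left _ (abs_nonneg _)
      simpa using this)
    (hk.mul_const C)
    (by
      have : ∀ᵐ σ : ℝ ∂volume, σ ≠ t := by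
        simp [ae_iff]
      filter_upwards [this] with σ hσ _
      have h1 := hFd (t - σ) (sub_ne_zero.mpr hσ.symm)
      have h2 : HasDerivAt (fun s => F (s - σ)) (g (t - σ)) t := h1.comp_sub_const t σ
      exact h2.const_mul _)
  obtain ⟨hgI, hd⟩ := key
  rw [aux_shift hβ htI g f' hgneg hgpos hgI] at hd
  have hd2 := (hd.hasDerivWithinAt (s := Icc 0 T)).const_mul (Real.Gamma (1 - β))⁻¹
  unfold RLD
  refine HasDerivWithinAt.derivWithin ?_ (uniqueDiffOn_Icc hT t htI)
  refine hd2.congr ?_ ?_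
  · intro s hs
    rw [aux_shift hβ hs F f hFneg hFpos (hFi s)]
  · rw [aux_shift hβ htI F f hFneg hFpos (hFi t)]

/-- The lower bound for a nondecreasing function. -/
theorem aux_RL_lower {β T : ℝ} (hT : 0 < T) (hβ : β ∈ Ioo (0:ℝ) 1) (f f' : ℝ → ℝ)
    (hf : ∀ t ∈ Icc (0:ℝ) T, HasDerivWithinAt f (f' t) (Icc 0 T) t)
    (hf' : ContinuousOn f' (Icc 0 T)) (h0 : f 0 = 0)
    (hpos : ∀ t ∈ Ioo (0:ℝ) T, 0 ≤ f' t) {t : ℝ} (ht : t ∈ Ioc 0 T) :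
    t ^ (-β) / Real.Gamma (1 - β) * f t ≤ RLD β T f t := by
  rw [aux_RL hT hβ f f' hf hf' h0 ht]
  have hΓ : 0 < Real.Gamma (1 - β) := Real.Gamma_pos_of_pos (by linarith [hβ.2])
  have hsub : Icc 0 t ⊆ Icc 0 T := Icc_subset_Icc_right ht.2
  have hi : IntervalIntegrable f' volume 0 t :=
    ContinuousOn.intervalIntegrable_of_Icc ht.1.le (hf'.mono hsub)
  have hft : ∫ τ in (0:ℝ)..t, f' τ = f t := by
    have := intervalIntegral.integral_eq_sub_of_hasDeriv_right_of_le ht.1.le (f := f) (f' := f')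
      (fun y hy => ((hf y (hsub hy)).continuousWithinAt).mono hsub)
      (fun y hy => by
        have := (hf y ⟨hy.1.le, hy.2.le.trans ht.2⟩)
        exact (this.hasDerivAt (Icc_mem_nhds hy.1 (hy.2.trans_le ht.2))).hasDerivWithinAt)
      hi
    rw [this, h0, sub_zero]
  rw [div_mul_eq_mul_div, div_eq_inv_mul]
  apply mul_le_mul_of_nonneg_left _ (inv_nonneg.mpr hΓ.le)
  rw [← hft, ← intervalIntegral.integral_const_mul]
  apply intervalIntegral.integral_mono_on_of_le_Ioo ht.1.le (hi.const_mul _)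
  · apply (aux_kernel_int hβ t 0 t).mul_continuousOn
    rw [uIcc_of_le ht.1.le]
    exact hf'.mono hsub
  · intro τ hτ
    apply mul_le_mul_of_nonneg_right _ (hpos τ ⟨hτ.1, hτ.2.trans_le ht.2⟩)
    exact Real.rpow_le_rpow_of_nonpos (by linarith [hτ.2]) (by linarith [hτ.1]) (by linarith [hβ.1])

theorem aux_Jdiff {β : ℝ} (hβ : β ∈ Ioo (0:ℝ) 1) (v : ℝ → ℝ) {t1 s t m e : ℝ}
    (h1 : 0 ≤ t1) (h1s : t1 ≤ s) (hst : s < t) (hv : ContinuousOn v (Icc 0 t)) (hm : 0 ≤ m)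
    (hpos : ∀ τ ∈ Ioo 0 t1, 0 ≤ v τ) (hlow : ∀ τ ∈ Icc 0 t, -m ≤ v τ)
    (hup : ∀ τ ∈ Icc s t, v τ ≤ -m + e) :
    (∫ τ in (0:ℝ)..t, (t - τ) ^ (-β) * v τ) - (∫ τ in (0:ℝ)..s, (s - τ) ^ (-β) * v τ)
      ≤ -m * ((t - s) * (t - t1) ^ (-β)) + e * ((t - s) ^ (1 - β) / (1 - β)) := by
  have hI : ∀ r a b, 0 ≤ a → a ≤ b → b ≤ t →
      IntervalIntegrable (fun τ => (r - τ) ^ (-β) * v τ) volume a b := by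
    intro r a b ha hab hb
    apply (aux_kernel_int hβ r a b).mul_continuousOn
    rw [uIcc_of_le hab]
    exact hv.mono (Icc_subset_Icc ha hb)
  have hK := aux_kernel_int hβ
  have hmono : ∀ τ, τ < s → (t - τ) ^ (-β) ≤ (s - τ) ^ (-β) := fun τ hτ =>
    Real.rpow_le_rpow_of_nonpos (by linarith) (by linarith) (by linarith [hβ.1])
  have e1 := intervalIntegral.integral_add_adjacent_intervals
    (hI t 0 t1 le_rfl h1 (by linarith)) (hI t t1 t h1 (by linarith) le_rfl)
  have e2 := intervalIntegral.integral_add_adjacent_intervals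
    (hI t t1 s h1 h1s hst.le) (hI t s t (by linarith) hst.le le_rfl)
  have e3 := intervalIntegral.integral_add_adjacent_intervals
    (hI s 0 t1 le_rfl h1 (by linarith)) (hI s t1 s h1 h1s hst.le)
  have i1 : ∫ τ in (0:ℝ)..t1, (t - τ) ^ (-β) * v τ ≤ ∫ τ in (0:ℝ)..t1, (s - τ) ^ (-β) * v τ := by
    apply intervalIntegral.integral_mono_on_of_le_Ioo h1 (hI t 0 t1 le_rfl h1 (by linarith))
      (hI s 0 t1 le_rfl h1 (by linarith))
    intro τ hτ
    exact mul_le_mul_of_nonneg_right (hmono τ (by linarith [hτ.2])) (hpos τ hτ)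
  have i2 : ∫ τ in t1..s, ((t - τ) ^ (-β) * v τ + m * (t - τ) ^ (-β)) ≤
      ∫ τ in t1..s, ((s - τ) ^ (-β) * v τ + m * (s - τ) ^ (-β)) := by
    apply intervalIntegral.integral_mono_on_of_le_Ioo h1s
      ((hI t t1 s h1 h1s hst.le).add ((hK t t1 s).const_mul m))
      ((hI s t1 s h1 h1s hst.le).add ((hK s t1 s).const_mul m))
    intro τ hτ
    have := mul_le_mul_of_nonneg_right (hmono τ hτ.2) (a := v τ + m)
      (by linarith [hlow τ ⟨by linarith [hτ.1], by linarith [hτ.2]⟩])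
    linarith
  rw [intervalIntegral.integral_add (hI t t1 s h1 h1s hst.le) ((hK t t1 s).const_mul m),
    intervalIntegral.integral_add (hI s t1 s h1 h1s hst.le) ((hK s t1 s).const_mul m),
    intervalIntegral.integral_const_mul, intervalIntegral.integral_const_mul] at i2
  have i3 : ∫ τ in s..t, (t - τ) ^ (-β) * v τ ≤ ∫ τ in s..t, (-m + e) * (t - τ) ^ (-β) := by
    apply intervalIntegral.integral_mono_on_of_le_Ioo hst.le
      (hI t s t (by linarith) hst.le le_rfl) ((hK t s t).const_mul _)
    intro τ hτ
    have := mul_le_mul_of_nonneg_left (hup τ ⟨hτ.1.le, hτ.2.le⟩)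
      (Real.rpow_nonneg (by linarith [hτ.2] : (0:ℝ) ≤ t - τ) (-β))
    linarith
  rw [intervalIntegral.integral_const_mul] at i3
  have e4 := intervalIntegral.integral_add_adjacent_intervals (hK t t1 s) (hK t s t)
  have i4 : (t - s) * (t - t1) ^ (-β) ≤
      (∫ τ in t1..t, (t - τ) ^ (-β)) - ∫ τ in t1..s, (s - τ) ^ (-β) := by
    rw [aux_kernel_val hβ, aux_kernel_val hβ]
    have hA : 0 < t - t1 := by linarith
    have hb1 : 0 < 1 - β := by linarith [hβ.2]
    have hber := rpow_one_add_le_one_add_mul_self (s := (s - t1) / (t - t1) - 1)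
      (p := 1 - β) (by have : 0 ≤ (s - t1) / (t - t1) := div_nonneg (by linarith) hA.le
                       linarith) hb1.le (by linarith [hβ.1])
    rw [add_sub_cancel, Real.div_rpow (by linarith) hA.le, div_le_iff₀ (by positivity)] at hber
    have hsp : (t - t1) ^ (1 - β) = (t - t1) * (t - t1) ^ (-β) := by
      rw [sub_eq_add_neg 1 β, Real.rpow_add hA, Real.rpow_one]
    rw [← sub_div, le_div_iff₀ hb1]
    have : (1 + (1 - β) * ((s - t1) / (t - t1) - 1)) * (t - t1) ^ (1 - β)
      = (t - t1) ^ (1 - β) - (1 - β) * ((t - s) * (t - t1) ^ (-β)) := by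
      rw [hsp]; field_simp; ring
    linarith
  have hv2 := aux_kernel_val hβ t s
  have := mul_le_mul_of_nonneg_left i4 hm
  rw [← hv2]
  nlinarith [e1, e2, e3, i1, i2, i3, e4, this]

theorem aux_second_deriv {φ φ' : ℝ → ℝ} {c : ℝ} (h1 : ∀ᶠ s in 𝓝 (0:ℝ), HasDerivAt φ (φ' s) s)
    (h2 : HasDerivAt φ' c 0) (hmin : IsLocalMin φ 0) : 0 ≤ c := by
  by_contra hc
  push Not at hc
  have hd : deriv φ =ᶠ[𝓝 0] φ' := h1.mono fun s hs => hs.deriv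
  have hdd : deriv (deriv φ) 0 = c := by rw [hd.deriv_eq]; exact h2.deriv
  have hmax := isLocalMax_of_deriv_deriv_neg (f := φ) (x₀ := 0) (by rw [hdd]; exact hc)
    hmin.deriv_eq_zero h1.self_of_nhds.continuousAt
  have hconst : φ =ᶠ[𝓝 0] fun _ => φ 0 := by
    filter_upwards [hmin, hmax] with y hy1 hy2
    exact le_antisymm hy2 hy1
  have : deriv (deriv φ) 0 = 0 := by
    have h3 : deriv φ =ᶠ[𝓝 0] fun _ => 0 := by
      have := hconst.deriv
      simpa using this
    rw [h3.deriv_eq]; simp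
  linarith

theorem aux_ell0 {n : ℕ} {aC : Fin n → Fin n → (Fin n → ℝ) → ℝ}
    {bC : Fin n → (Fin n → ℝ) → ℝ} {Ω : Set (Fin n → ℝ)} (hΩo : IsOpen Ω)
    (hell : IsElliptic aC Ω) (w : (Fin n → ℝ) → ℝ) {x : Fin n → ℝ} (hx : x ∈ Ω)
    (hw : ∀ y ∈ Ω, DifferentiableAt ℝ w y ∧ ∀ j, DifferentiableAt ℝ (pd j w) y)
    (hmin : IsLocalMin w x) : 0 ≤ ellOp aC bC w x := by
  have hgrad : ∀ j, pd j w x = 0 := by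
    intro j; unfold pd; rw [hmin.fderiv_eq_zero]; rfl
  set f' : (Fin n → ℝ) → ((Fin n → ℝ) →L[ℝ] ℝ) := fun y =>
    ∑ j, pd j w y • (ContinuousLinearMap.proj j : (Fin n → ℝ) →L[ℝ] ℝ) with hf'
  set f'' : (Fin n → ℝ) →L[ℝ] ((Fin n → ℝ) →L[ℝ] ℝ) :=
    ∑ j, (fderiv ℝ (pd j w) x).smulRight (ContinuousLinearMap.proj j : (Fin n → ℝ) →L[ℝ] ℝ)
    with hf''
  have hfd : ∀ y ∈ Ω, HasFDerivAt w (f' y) y := by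
    intro y hy
    have h := (hw y hy).1.hasFDerivAt
    have : f' y = fderiv ℝ w y := by
      ext ξ
      simp only [hf', sum_apply, smul_apply,
        ContinuousLinearMap.proj_apply, smul_eq_mul]
      conv_rhs => rw [pi_eq_sum_univ' ξ, map_sum]
      apply Finset.sum_congr rfl
      intro j _
      rw [map_smul]
      unfold pd
      simp [mul_comm]
    rw [this]; exact h
  have hev : ∀ᶠ y in 𝓝 x, HasFDerivAt w (f' y) y := by
    filter_upwards [hΩo.mem_nhds hx] with y hy using hfd y hy
  have hf2 : HasFDerivAt f' f'' x := by
    apply HasFDerivAt.fun_sum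
    intro j _
    exact HasFDerivAt.smul_const (F := (Fin n → ℝ) →L[ℝ] ℝ) ((hw x hx).2 j).hasFDerivAt
      (ContinuousLinearMap.proj j : (Fin n → ℝ) →L[ℝ] ℝ)
  have hsym := second_derivative_symmetric_of_eventually hev hf2
  have happ : ∀ ξ η, f'' ξ η = ∑ j, fderiv ℝ (pd j w) x ξ * η j := by
    intro ξ η
    simp [hf'']
  have hbasis : ∀ i j, f'' (Pi.single i 1) (Pi.single j 1) = pd i (pd j w) x := by
    intro i j
    rw [happ, Finset.sum_eq_single j]
    · simp [pd]
    · intro k _ hk; simp [Pi.single_apply, hk]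
    · simp
  have hnn : ∀ ξ, 0 ≤ f'' ξ ξ := by
    intro ξ
    have hl : ∀ s : ℝ, HasDerivAt (fun s : ℝ => x + s • ξ) ξ s := by
      intro s
      have := ((hasDerivAt_id s).smul_const ξ).const_add x
      simpa using this
    have hc : ContinuousAt (fun s : ℝ => x + s • ξ) 0 := (hl 0).continuousAt
    have hx0 : x + (0:ℝ) • ξ = x := by simp
    have hc' : Tendsto (fun s : ℝ => x + s • ξ) (𝓝 0) (𝓝 x) := by
      have := hc.tendsto; rwa [hx0] at this
    refine aux_second_deriv (φ := fun s => w (x + s • ξ)) (φ' := fun s => f' (x + s • ξ) ξ) ?_ ?_ ?_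
    · filter_upwards [hc'.eventually hev] with s hs
      exact hs.comp_hasDerivAt s (hl s)
    · have h1 : HasFDerivAt f' f'' (x + (0:ℝ) • ξ) := by rw [hx0]; exact hf2
      have h2 := h1.comp_hasDerivAt (0:ℝ) (hl 0)
      have h3 := h2.clm_apply (hasDerivAt_const (0:ℝ) ξ)
      simpa using h3
    · have : ∀ᶠ s in 𝓝 (0:ℝ), w x ≤ w (x + s • ξ) := hc'.eventually hmin
      simpa [IsLocalMin, IsMinFilter] using this
  have hexp : ∀ ξ, f'' ξ ξ = ∑ i, ∑ j, ξ i * (pd i (pd j w) x * ξ j) := by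
    intro ξ
    conv_lhs => rw [pi_eq_sum_univ' ξ]
    simp only [map_sum, map_smul, sum_apply, smul_apply,
      smul_eq_mul]
    apply Finset.sum_congr rfl
    intro i _
    rw [Finset.mul_sum]
    apply Finset.sum_congr rfl
    intro j _
    rw [hsym, hbasis]; ring
  let H : Matrix (Fin n) (Fin n) ℝ := fun i j => pd i (pd j w) x
  have hH : H.PosSemidef := by
    refine Matrix.PosSemidef.of_dotProduct_mulVec_nonneg ?_ ?_
    · ext i j
      rw [Matrix.conjTranspose_apply, star_trivial]
      show pd j (pd i w) x = pd i (pd j w) x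
      rw [← hbasis, ← hbasis, hsym]
    · intro ξ
      have := hnn ξ
      rw [hexp] at this
      simp only [dotProduct, Matrix.mulVec, H, Finset.mul_sum]
      simpa using this
  obtain ⟨B, hB⟩ : ∃ B : Matrix (Fin n) (Fin n) ℝ, H = B.conjTranspose * B := by
    open scoped MatrixOrder in
    obtain ⟨B, hB⟩ := CStarAlgebra.nonneg_iff_eq_star_mul_self.mp hH.nonneg
    exact ⟨B, hB⟩
  have hHB : ∀ i j, pd i (pd j w) x = ∑ k, B k i * B k j := by
    intro i j
    have : H i j = (B.conjTranspose * B) i j := by rw [hB]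
    simpa [Matrix.mul_apply, H] using this
  obtain ⟨c, hc, hE⟩ := hell
  unfold ellOp
  have h2 : ∑ j, bC j x * pd j w x = 0 := by simp [hgrad]
  rw [h2, add_zero]
  have h3 : ∑ i, ∑ j, aC i j x * pd i (pd j w) x
      = ∑ k, ∑ i, ∑ j, aC i j x * B k i * B k j := by
    simp only [hHB, Finset.mul_sum]
    simp only [← mul_assoc]
    conv_rhs => rw [Finset.sum_comm]
    apply Finset.sum_congr rfl
    intro i _
    rw [Finset.sum_comm]
  rw [h3]
  apply Finset.sum_nonneg
  intro k _
  refine le_trans ?_ (hE x hx (B k))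
  exact mul_nonneg hc.le (Finset.sum_nonneg fun i _ => sq_nonneg _)

theorem aux_ell {n : ℕ} {aC : Fin n → Fin n → (Fin n → ℝ) → ℝ}
    {bC : Fin n → (Fin n → ℝ) → ℝ} {Ω : Set (Fin n → ℝ)} (hΩo : IsOpen Ω)
    (hell : IsElliptic aC Ω) (p q : (Fin n → ℝ) → ℝ) {x : Fin n → ℝ} (hx : x ∈ Ω)
    (hp : ∀ y ∈ Ω, DifferentiableAt ℝ p y ∧ ∀ j, DifferentiableAt ℝ (pd j p) y)
    (hq : ∀ y ∈ Ω, DifferentiableAt ℝ q y ∧ ∀ j, DifferentiableAt ℝ (pd j q) y)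
    (hmin : IsLocalMin (fun y => p y - q y) x) : ellOp aC bC q x ≤ ellOp aC bC p x := by
  have h1 : ∀ j, ∀ y ∈ Ω, pd j (fun y => p y - q y) y = pd j p y - pd j q y := by
    intro j y hy
    unfold pd
    rw [fderiv_fun_sub (hp y hy).1 (hq y hy).1]; rfl
  have h1' : ∀ j, ∀ y ∈ Ω, pd j (fun y => p y - q y) =ᶠ[𝓝 y] fun y => pd j p y - pd j q y := by
    intro j y hy
    filter_upwards [hΩo.mem_nhds hy] with z hz using h1 j z hz
  have h2 : ∀ i j, pd i (pd j (fun y => p y - q y)) x = pd i (pd j p) x - pd i (pd j q) x := by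
    intro i j
    have : pd i (pd j (fun y => p y - q y)) x = pd i (fun y => pd j p y - pd j q y) x := by
      unfold pd at *
      rw [(h1' j x hx).fderiv_eq]
    rw [this]
    show fderiv ℝ (fun y => pd j p y - pd j q y) x _ = _
    rw [fderiv_fun_sub ((hp x hx).2 j) ((hq x hx).2 j)]; rfl
  have h0 := aux_ell0 (aC := aC) (bC := bC) hΩo hell (fun y => p y - q y) hx
    (fun y hy => ⟨(hp y hy).1.sub (hq y hy).1, fun j =>
      (((hp y hy).2 j).sub ((hq y hy).2 j)).congr_of_eventuallyEq (h1' j y hy)⟩) hmin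
  have : ellOp aC bC (fun y => p y - q y) x = ellOp aC bC p x - ellOp aC bC q x := by
    unfold ellOp
    simp only [h2, h1 _ x hx, mul_sub, Finset.sum_sub_distrib]
    ring
  linarith

theorem aux_ell_congr {n : ℕ} (aC : Fin n → Fin n → (Fin n → ℝ) → ℝ)
    (bC : Fin n → (Fin n → ℝ) → ℝ) {Ω : Set (Fin n → ℝ)} (hΩo : IsOpen Ω)
    (p q : (Fin n → ℝ) → ℝ) {x : Fin n → ℝ} (hx : x ∈ Ω) (h : ∀ y ∈ Ω, p y = q y) :
    ellOp aC bC p x = ellOp aC bC q x := by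
  have h1 : ∀ j, ∀ y ∈ Ω, pd j p y = pd j q y := by
    intro j y hy
    have : p =ᶠ[𝓝 y] q := by filter_upwards [hΩo.mem_nhds hy] with z hz using h z hz
    unfold pd; rw [this.fderiv_eq]
  have h2 : ∀ i j, pd i (pd j p) x = pd i (pd j q) x := by
    intro i j
    have : pd j p =ᶠ[𝓝 x] pd j q := by filter_upwards [hΩo.mem_nhds hx] with z hz using h1 j z hz
    show fderiv ℝ (pd j p) x _ = fderiv ℝ (pd j q) x _
    rw [this.fderiv_eq]
  unfold ellOp
  simp only [h2, h1 _ x hx]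

/-- Chain rule along a curve. -/
theorem aux_chain {T : ℝ} (p pw pt : ℝ → ℝ → ℝ)
    (hpw : ∀ w t, HasDerivAt (fun v => p v t) (pw w t) w)
    (hpt : ∀ w, ∀ t ∈ Icc (0:ℝ) T, HasDerivWithinAt (fun τ => p w τ) (pt w t) (Icc 0 T) t)
    (hc : ContinuousOn (fun q : ℝ × ℝ => pw q.1 q.2) (univ ×ˢ Icc 0 T))
    (y : ℝ → ℝ) {y' t : ℝ} (ht : t ∈ Icc 0 T) (hy : HasDerivWithinAt y y' (Icc 0 T) t) :
    HasDerivWithinAt (fun τ => p (y τ) τ) (pw (y t) t * y' + pt (y t) t) (Icc 0 T) t := by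
  have hmv : ∀ s, ∃ ξ, |ξ - y t| ≤ |y s - y t| ∧
      p (y s) s - p (y t) s = pw ξ s * (y s - y t) := by
    intro s
    rcases lt_trichotomy (y s) (y t) with h | h | h
    · obtain ⟨ξ, hξ, he⟩ := exists_hasDerivAt_eq_slope (fun v => p v s) (fun v => pw v s) h
        (fun v _ => (hpw v s).continuousAt.continuousWithinAt) (fun v _ => hpw v s)
      refine ⟨ξ, ?_, ?_⟩
      · rw [abs_of_neg (by linarith [hξ.2]), abs_of_neg (by linarith)]; linarith [hξ.1]
      · rw [he]
        have : y t - y s ≠ 0 := by linarith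
        field_simp; ring
    · exact ⟨y t, by simp, by simp [h]⟩
    · obtain ⟨ξ, hξ, he⟩ := exists_hasDerivAt_eq_slope (fun v => p v s) (fun v => pw v s) h
        (fun v _ => (hpw v s).continuousAt.continuousWithinAt) (fun v _ => hpw v s)
      refine ⟨ξ, ?_, ?_⟩
      · rw [abs_of_pos (by linarith [hξ.1]), abs_of_pos (by linarith)]; linarith [hξ.2]
      · rw [he]
        have : y s - y t ≠ 0 := by linarith
        field_simp
  choose ξ hξ1 hξ2 using hmv
  have hξt : ξ t = y t := by
    have := hξ1 t
    simp only [sub_self, abs_zero] at this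
    exact sub_eq_zero.mp (abs_nonpos_iff.mp this)
  have hyc : Tendsto y (𝓝[Icc 0 T] t) (𝓝 (y t)) := hy.continuousWithinAt
  have hξc : Tendsto ξ (𝓝[Icc 0 T] t) (𝓝 (y t)) := by
    rw [tendsto_iff_dist_tendsto_zero] at hyc ⊢
    exact squeeze_zero (fun _ => dist_nonneg) (fun s => hξ1 s) hyc
  have hpwc : Tendsto (fun s => pw (ξ s) s) (𝓝[Icc 0 T] t) (𝓝 (pw (y t) t)) := by
    have h1 := hc (y t, t) ⟨mem_univ _, ht⟩
    have h2 : Tendsto (fun s => (ξ s, s)) (𝓝[Icc 0 T] t) (𝓝[univ ×ˢ Icc 0 T] (y t, t)) := by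
      apply tendsto_nhdsWithin_iff.mpr
      refine ⟨hξc.prodMk_nhds (tendsto_nhdsWithin_of_tendsto_nhds tendsto_id), ?_⟩
      filter_upwards [self_mem_nhdsWithin] with s hs
      exact ⟨mem_univ _, hs⟩
    exact h1.tendsto.comp h2
  have hA : HasDerivWithinAt (fun s => p (y s) s - p (y t) s) (pw (y t) t * y') (Icc 0 T) t := by
    rw [hasDerivWithinAt_iff_tendsto_slope] at hy ⊢
    have hmul := (hpwc.mono_left (nhdsWithin_mono t sdiff_subset)).mul hy
    refine hmul.congr fun s => ?_
    simp only [slope, vsub_eq_sub, smul_eq_mul]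
    rw [hξ2 s, hξ2 t]; simp; ring
  have := hA.add (hpt (y t) t ht)
  refine this.congr_of_eventuallyEq ?_ ?_
  · exact Eventually.of_forall fun s => by simp
  · simp

theorem aux_step {n : ℕ} {T β β' K M δ t1 : ℝ} (hβ : β ∈ Ioo (0:ℝ) 1)
    (hβ' : β < β') (hK0 : 0 ≤ K)
    {Ω : Set (Fin n → ℝ)} (hΩo : IsOpen Ω) (hΩb : Bornology.IsBounded Ω)
    (u v F : ℝ → (Fin n → ℝ) → ℝ)
    (hvc : ContinuousOn (fun p : ℝ × (Fin n → ℝ) => v p.1 p.2) (Icc 0 T ×ˢ closure Ω))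
    (huc : ∀ t ∈ Icc (0:ℝ) T, ContinuousOn (u t) (closure Ω))
    (hud : ∀ x ∈ closure Ω, ∀ t ∈ Icc (0:ℝ) T,
      HasDerivWithinAt (fun τ => u τ x) (v t x) (Icc 0 T) t)
    (hK : ∀ x ∈ closure Ω, ∀ s ∈ Icc (0:ℝ) T, ∀ t ∈ Icc (0:ℝ) T,
      |v t x - v s x| ≤ K * |t - s| ^ β')
    (hfr : ∀ t ∈ Icc (0:ℝ) T, ∀ x ∈ frontier Ω, 0 ≤ v t x)
    (hF : ∀ x ∈ Ω, ∀ s t, 0 ≤ s → s < t → t < T → ∀ m, 0 ≤ m →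
      (∀ τ ∈ Icc s t, -m ≤ v τ x ∧ v τ x ≤ 0) → -(M * m * (t - s)) ≤ F t x - F s x)
    (hcomp : ∀ x ∈ Ω, ∀ s t, 0 ≤ s → s < t → t < T → IsLocalMin (fun y => u t y - u s y) x →
      F t x - F s x ≤ (Real.Gamma (1 - β))⁻¹ * ((∫ τ in (0:ℝ)..t, (t - τ) ^ (-β) * v τ x)
        - ∫ τ in (0:ℝ)..s, (s - τ) ^ (-β) * v τ x))
    (hδ : 0 < δ) (hδM : Real.Gamma (1 - β) * M < δ ^ (-β)) (ht1 : 0 ≤ t1) (htδ : t1 + δ < T)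
    (hpos : ∀ τ ∈ Ico 0 t1, ∀ x ∈ closure Ω, 0 ≤ v τ x) :
    ∀ τ ∈ Icc 0 (t1 + δ), ∀ x ∈ closure Ω, 0 ≤ v τ x := by
  intro τ₁ hτ₁ x₁ hx₁
  by_contra hneg
  push Not at hneg
  have hcl : IsCompact (closure Ω) := hΩb.isCompact_closure
  have hΓ : 0 < Real.Gamma (1 - β) := Real.Gamma_pos_of_pos (by linarith [hβ.2])
  have hb1 : 0 < 1 - β := by linarith [hβ.2]
  have hIsub : Icc 0 (t1 + δ) ⊆ Icc 0 T := Icc_subset_Icc_right htδ.le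
  obtain ⟨⟨t0, x0⟩, ⟨ht0, hx0⟩, hmin⟩ := (isCompact_Icc.prod hcl).exists_isMinOn
    ⟨(τ₁, x₁), hτ₁, hx₁⟩ (hvc.mono (prod_mono_left hIsub))
  simp only at ht0 hx0
  have hmin' : ∀ τ ∈ Icc 0 (t1 + δ), ∀ x ∈ closure Ω, v t0 x0 ≤ v τ x := by
    intro τ hτ x hx
    exact hmin (show (τ, x) ∈ Icc 0 (t1 + δ) ×ˢ closure Ω from ⟨hτ, hx⟩)
  obtain ⟨m, hm⟩ : ∃ m, v t0 x0 = -m := ⟨-v t0 x0, by simp⟩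
  have hm0 : 0 < m := by
    have := hmin' τ₁ hτ₁ x₁ hx₁
    linarith
  have ht01 : t1 ≤ t0 := by
    by_contra h
    push Not at h
    have := hpos t0 ⟨ht0.1, h⟩ x0 hx0
    linarith
  -- choose h small
  have hlim1 : Tendsto (fun h : ℝ => 2 * K * h ^ β') (𝓝[>] 0) (𝓝 0) := by
    have : ContinuousAt (fun h : ℝ => 2 * K * h ^ β') 0 :=
      continuousAt_const.mul (Real.continuousAt_rpow_const _ _ (Or.inr (by linarith [hβ.1])))
    have h2 := this.tendsto
    simp only [Real.zero_rpow (by linarith [hβ.1] : β' ≠ 0), mul_zero] at h2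
    exact h2.mono_left nhdsWithin_le_nhds
  have hlim2 : Tendsto (fun h : ℝ => 2 * K * h ^ (β' - β) / (1 - β)) (𝓝[>] 0) (𝓝 0) := by
    have : ContinuousAt (fun h : ℝ => 2 * K * h ^ (β' - β) / (1 - β)) 0 :=
      (continuousAt_const.mul (Real.continuousAt_rpow_const _ _
        (Or.inr (by linarith [hβ.1])))).div_const _
    have h2 := this.tendsto
    simp only [Real.zero_rpow (by linarith [hβ.1] : β' - β ≠ 0), mul_zero, zero_div] at h2
    exact h2.mono_left nhdsWithin_le_nhds
  have hgap : 0 < m * (δ ^ (-β) - Real.Gamma (1 - β) * M) := mul_pos hm0 (by linarith)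
  have hstex : ∀ᶠ h in 𝓝[>] (0:ℝ), h < δ ∧ (t1 < t0 → h < t0 - t1) := by
    have e1 : ∀ᶠ h in 𝓝[>] (0:ℝ), h < δ := nhdsWithin_le_nhds (Iio_mem_nhds hδ)
    by_cases hlt : t1 < t0
    · have e2 : ∀ᶠ h in 𝓝[>] (0:ℝ), h < t0 - t1 :=
        nhdsWithin_le_nhds (Iio_mem_nhds (by linarith))
      filter_upwards [e1, e2] with h a b using ⟨a, fun _ => b⟩
    · filter_upwards [e1] with h a using ⟨a, fun c => absurd c hlt⟩
  obtain ⟨h, ⟨⟨hh1, hh2⟩, hh3, hh4⟩, hh0⟩ := ((hstex.and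
    ((hlim1.eventually (gt_mem_nhds hm0)).and (hlim2.eventually (gt_mem_nhds hgap)))).and
      self_mem_nhdsWithin).exists
  have hh0 : 0 < h := hh0
  obtain ⟨s, t, hs1, hs0, ht0', htT, hts⟩ : ∃ s t, t1 ≤ s ∧ s ≤ t0 ∧ t0 ≤ t ∧ t ≤ t1 + δ ∧
      t - s = h := by
    by_cases hlt : t1 < t0
    · exact ⟨t0 - h, t0, by linarith [hh2 hlt], by linarith, le_rfl, ht0.2, by ring⟩
    · have : t0 = t1 := le_antisymm (not_lt.mp hlt) ht01
      exact ⟨t0, t0 + h, ht01, le_rfl, by linarith, by linarith, by ring⟩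
  have hst : s < t := by linarith
  have hs0' : 0 ≤ s := by linarith
  have htT' : t < T := by linarith
  have hsI : s ∈ Icc 0 T := ⟨hs0', by linarith⟩
  have htI : t ∈ Icc 0 T := ⟨by linarith, by linarith⟩
  have hIst : Icc s t ⊆ Icc 0 T := Icc_subset_Icc hs0' htT'.le
  -- Hölder oscillation on [s,t]
  have hosc : ∀ x ∈ closure Ω, ∀ a ∈ Icc s t, ∀ b ∈ Icc s t, v a x ≤ v b x + K * h ^ β' := by
    intro x hx a ha b hb
    have h1 := hK x hx b (hIst hb) a (hIst ha)
    have h2 : |a - b| ≤ h := by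
      rw [abs_le]; constructor <;> linarith [ha.1, ha.2, hb.1, hb.2]
    have h3 : |a - b| ^ β' ≤ h ^ β' :=
      Real.rpow_le_rpow (abs_nonneg _) h2 (by linarith [hβ.1])
    have h4 := mul_le_mul_of_nonneg_left h3 hK0
    linarith [le_abs_self (v a x - v b x)]
  have hmv : ∀ x ∈ closure Ω, ∃ ξ ∈ Icc s t, u t x - u s x = h * v ξ x := by
    intro x hx
    obtain ⟨ξ, hξ, he⟩ := exists_hasDerivAt_eq_slope (fun τ => u τ x) (fun τ => v τ x) hst
      (fun τ hτ => ((hud x hx τ (hIst hτ)).continuousWithinAt).mono hIst)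
      (fun τ hτ => (hud x hx τ (hIst ⟨hτ.1.le, hτ.2.le⟩)).hasDerivAt
        (Icc_mem_nhds (by linarith [hτ.1]) (by linarith [hτ.2])))
    refine ⟨ξ, ⟨hξ.1.le, hξ.2.le⟩, ?_⟩
    rw [he, hts]; field_simp
  obtain ⟨xh, hxh, hxmin⟩ := hcl.exists_isMinOn ⟨x0, hx0⟩ ((huc t htI).sub (huc s hsI))
  have hup : ∀ τ ∈ Icc s t, v τ xh ≤ -m + 2 * K * h ^ β' := by
    intro τ hτ
    obtain ⟨ξ0, hξ0, e0⟩ := hmv x0 hx0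
    obtain ⟨ξ, hξ, e1⟩ := hmv xh hxh
    have h1 : u t xh - u s xh ≤ u t x0 - u s x0 := hxmin hx0
    rw [e0, e1] at h1
    have h2 := le_of_mul_le_mul_left h1 hh0
    have h3 := hosc x0 hx0 ξ0 hξ0 t0 ⟨hs0, ht0'⟩
    have h4 := hosc xh hxh τ hτ ξ hξ
    linarith
  have hneg' : ∀ τ ∈ Icc s t, v τ xh < 0 := fun τ hτ => by linarith [hup τ hτ]
  have hxΩ : xh ∈ Ω := by
    by_contra hno
    have hfrx : xh ∈ frontier Ω := by
      rw [hΩo.frontier_eq]; exact ⟨hxh, hno⟩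
    have := hfr t htI xh hfrx
    linarith [hneg' t ⟨hst.le, le_rfl⟩]
  have hloc : IsLocalMin (fun y => u t y - u s y) xh :=
    hxmin.isLocalMin (mem_of_superset (hΩo.mem_nhds hxΩ) subset_closure)
  have hlow : ∀ τ ∈ Icc 0 t, -m ≤ v τ xh := by
    intro τ hτ
    rw [← hm]; exact hmin' τ ⟨hτ.1, hτ.2.trans htT⟩ xh hxh
  have c1 := hcomp xh hxΩ s t hs0' hst htT' hloc
  have c2 := hF xh hxΩ s t hs0' hst htT' m hm0.le
    (fun τ hτ => ⟨hlow τ ⟨by linarith [hτ.1], hτ.2⟩, (hneg' τ hτ).le⟩)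
  have hvx : ContinuousOn (fun τ => v τ xh) (Icc 0 t) := by
    have : ContinuousOn (fun τ : ℝ => (τ, xh)) (Icc 0 t) := by fun_prop
    exact hvc.comp this (fun τ hτ => ⟨⟨hτ.1, hτ.2.trans htT'.le⟩, hxh⟩)
  have c3 := aux_Jdiff hβ (fun τ => v τ xh) ht1 hs1 hst hvx hm0.le
    (fun τ hτ => hpos τ ⟨hτ.1.le, hτ.2⟩ xh hxh) hlow (e := 2 * K * h ^ β') hup
  have c4 := mul_le_mul_of_nonneg_left c3 (inv_nonneg.mpr hΓ.le)
  rw [hts] at c4 c2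
  have c5 : -(M * m * h) ≤ (Real.Gamma (1 - β))⁻¹ *
      (-m * (h * (t - t1) ^ (-β)) + 2 * K * h ^ β' * (h ^ (1 - β) / (1 - β))) := by
    linarith
  rw [inv_mul_eq_div, le_div_iff₀ hΓ] at c5
  have c6 : δ ^ (-β) ≤ (t - t1) ^ (-β) :=
    Real.rpow_le_rpow_of_nonpos (by linarith) (by linarith) (by linarith [hβ.1])
  have c7 : h ^ β' * h ^ (1 - β) = h * h ^ (β' - β) := by
    rw [← Real.rpow_add hh0, ← Real.rpow_one_add' hh0.le (by linarith)]
    congr 1; ring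
  have c8 : 2 * K * h ^ β' * (h ^ (1 - β) / (1 - β)) = h * (2 * K * h ^ (β' - β) / (1 - β)) := by
    calc _ = 2 * K * (h ^ β' * h ^ (1 - β)) / (1 - β) := by ring
      _ = _ := by rw [c7]; ring
  rw [c8] at c5
  have c9 : h * (m * (t - t1) ^ (-β)) ≤
      h * (2 * K * h ^ (β' - β) / (1 - β) + Real.Gamma (1 - β) * M * m) := by linarith
  have c10 := le_of_mul_le_mul_left c9 hh0
  have c11 := mul_le_mul_of_nonneg_left c6 hm0.le
  linarith

theorem aux_mono {n : ℕ} {T β β' K M : ℝ} (hβ : β ∈ Ioo (0:ℝ) 1)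
    (hβ' : β < β') (hK0 : 0 ≤ K)
    {Ω : Set (Fin n → ℝ)} (hΩo : IsOpen Ω) (hΩb : Bornology.IsBounded Ω)
    (u v F : ℝ → (Fin n → ℝ) → ℝ)
    (hvc : ContinuousOn (fun p : ℝ × (Fin n → ℝ) => v p.1 p.2) (Icc 0 T ×ˢ closure Ω))
    (huc : ∀ t ∈ Icc (0:ℝ) T, ContinuousOn (u t) (closure Ω))
    (hud : ∀ x ∈ closure Ω, ∀ t ∈ Icc (0:ℝ) T,
      HasDerivWithinAt (fun τ => u τ x) (v t x) (Icc 0 T) t)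
    (hK : ∀ x ∈ closure Ω, ∀ s ∈ Icc (0:ℝ) T, ∀ t ∈ Icc (0:ℝ) T,
      |v t x - v s x| ≤ K * |t - s| ^ β')
    (hfr : ∀ t ∈ Icc (0:ℝ) T, ∀ x ∈ frontier Ω, 0 ≤ v t x)
    (hF : ∀ x ∈ Ω, ∀ s t, 0 ≤ s → s < t → t < T → ∀ m, 0 ≤ m →
      (∀ τ ∈ Icc s t, -m ≤ v τ x ∧ v τ x ≤ 0) → -(M * m * (t - s)) ≤ F t x - F s x)
    (hcomp : ∀ x ∈ Ω, ∀ s t, 0 ≤ s → s < t → t < T → IsLocalMin (fun y => u t y - u s y) x →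
      F t x - F s x ≤ (Real.Gamma (1 - β))⁻¹ * ((∫ τ in (0:ℝ)..t, (t - τ) ^ (-β) * v τ x)
        - ∫ τ in (0:ℝ)..s, (s - τ) ^ (-β) * v τ x)) :
    ∀ t ∈ Ioo 0 T, ∀ x ∈ closure Ω, 0 ≤ v t x := by
  intro t ht x hx
  have hlim : Tendsto (fun d : ℝ => d ^ (-β)) (𝓝[>] 0) atTop :=
    tendsto_rpow_neg_nhdsGT_zero (by linarith [hβ.1])
  -- pick a number of steps
  have hlim2 : Tendsto (fun N : ℕ => t / ((N : ℝ) + 1)) atTop (𝓝[>] 0) := by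
    apply tendsto_nhdsWithin_iff.mpr
    refine ⟨?_, Eventually.of_forall fun N => div_pos ht.1 (by positivity)⟩
    have := tendsto_one_div_add_atTop_nhds_zero_nat (𝕜 := ℝ)
    have h2 := this.const_mul t
    simpa [div_eq_mul_inv] using h2
  obtain ⟨N, hN⟩ := ((hlim.comp hlim2).eventually_gt_atTop (Real.Gamma (1 - β) * M)).exists
  simp only [Function.comp] at hN
  set δ := t / ((N : ℝ) + 1) with hδ
  have hN1 : (0:ℝ) < (N : ℝ) + 1 := by positivity
  have hδ0 : 0 < δ := div_pos ht.1 hN1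
  have hδt : ((N : ℝ) + 1) * δ = t := by rw [hδ]; field_simp
  have hind : ∀ k : ℕ, k ≤ N + 1 → ∀ τ ∈ Ico 0 (k * δ), ∀ x ∈ closure Ω, 0 ≤ v τ x := by
    intro k
    induction k with
    | zero => intro _ τ hτ; simp at hτ
    | succ k ih =>
      intro hk τ hτ y hy
      have hkN : (k : ℝ) + 1 ≤ (N : ℝ) + 1 := by exact_mod_cast hk
      have h1 : (k : ℝ) * δ + δ ≤ t := by
        rw [← hδt]
        have := mul_le_mul_of_nonneg_right hkN hδ0.le
        linarith
      have := aux_step hβ hβ' hK0 hΩo hΩb u v F hvc huc hud hK hfr hF hcomp hδ0 hN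
        (t1 := k * δ) (by positivity) (by linarith [ht.2]) (ih (by omega))
      refine this τ ⟨hτ.1, ?_⟩ y hy
      have h2 := hτ.2
      push_cast at h2
      linarith
  -- one more use of the step gives the closed interval
  have := aux_step hβ hβ' hK0 hΩo hΩb u v F hvc huc hud hK hfr hF hcomp hδ0 hN
    (t1 := N * δ) (by positivity) (by linarith [ht.2]) (hind N (by omega))
  exact this t ⟨ht.1.le, by linarith⟩ x hx

theorem aux_holder {n : ℕ} {T γ : ℝ} (hγ1 : γ ≤ 1) {Ω : Set (Fin n → ℝ)}
    (v : ℝ → (Fin n → ℝ) → ℝ) (h : MemHolderFam γ T (nC0 Ω) v) :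
    ∃ K, 0 ≤ K ∧ ∀ x ∈ closure Ω, ∀ s ∈ Icc (0:ℝ) T, ∀ t ∈ Icc (0:ℝ) T,
      |v t x - v s x| ≤ K * |t - s| ^ γ := by
  have h1 := h.1
  unfold hNorm at h1
  rw [if_pos hγ1] at h1
  have hq : hQuot γ T (nC0 Ω) v ≠ ⊤ := (ENNReal.add_ne_top.mp h1).2
  refine ⟨(hQuot γ T (nC0 Ω) v).toReal, ENNReal.toReal_nonneg, ?_⟩
  intro x hx s hs t ht
  by_cases hst : t = s
  · subst hst
    simp only [sub_self, abs_zero]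
    exact mul_nonneg ENNReal.toReal_nonneg (Real.rpow_nonneg le_rfl _)
  have hpos : 0 < |t - s| ^ γ := Real.rpow_pos_of_pos (abs_pos.mpr (sub_ne_zero.mpr hst)) _
  have h2 : nC0 Ω (fun x => v t x - v s x) / ENNReal.ofReal (|t - s| ^ γ) ≤
      hQuot γ T (nC0 Ω) v := by
    unfold hQuot
    exact le_iSup₂_of_le s hs (le_iSup₂_of_le t ht le_rfl)
  have h3 : ENNReal.ofReal |v t x - v s x| ≤ nC0 Ω (fun x => v t x - v s x) := by
    unfold nC0
    exact le_iSup₂_of_le x hx le_rfl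
  rw [ENNReal.div_le_iff (by simpa using hpos) (by simp)] at h2
  have h4 := h3.trans h2
  rw [← ENNReal.ofReal_toReal hq, ← ENNReal.ofReal_mul ENNReal.toReal_nonneg] at h4
  rwa [ENNReal.ofReal_le_ofReal_iff (mul_nonneg ENNReal.toReal_nonneg hpos.le)] at h4

theorem aux_joint {n : ℕ} {T γ K : ℝ} (hγ : 0 < γ) {Ω : Set (Fin n → ℝ)}
    (v : ℝ → (Fin n → ℝ) → ℝ)
    (hK : ∀ x ∈ closure Ω, ∀ s ∈ Icc (0:ℝ) T, ∀ t ∈ Icc (0:ℝ) T,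
      |v t x - v s x| ≤ K * |t - s| ^ γ)
    (hc : ∀ t ∈ Icc (0:ℝ) T, ContinuousOn (v t) (closure Ω)) :
    ContinuousOn (fun p : ℝ × (Fin n → ℝ) => v p.1 p.2) (Icc 0 T ×ˢ closure Ω) := by
  rintro ⟨t, x⟩ ⟨ht, hx⟩
  have h1 : Tendsto (fun p : ℝ × (Fin n → ℝ) => v t p.2) (𝓝[Icc 0 T ×ˢ closure Ω] (t, x))
      (𝓝 (v t x)) := by
    have h2 : Tendsto (fun p : ℝ × (Fin n → ℝ) => p.2) (𝓝[Icc 0 T ×ˢ closure Ω] (t, x))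
        (𝓝[closure Ω] x) := by
      apply tendsto_nhdsWithin_iff.mpr
      refine ⟨tendsto_nhdsWithin_of_tendsto_nhds continuous_snd.continuousAt, ?_⟩
      filter_upwards [self_mem_nhdsWithin] with p hp using hp.2
    exact (hc t ht x hx).tendsto.comp h2
  have h3 : Tendsto (fun p : ℝ × (Fin n → ℝ) => K * |p.1 - t| ^ γ)
      (𝓝[Icc 0 T ×ˢ closure Ω] (t, x)) (𝓝 0) := by
    have : Continuous (fun p : ℝ × (Fin n → ℝ) => K * |p.1 - t| ^ γ) :=
      continuous_const.mul ((continuous_fst.sub continuous_const).abs.rpow_const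
        fun _ => Or.inr hγ.le)
    have h4 := this.tendsto (t, x)
    simp only [sub_self, abs_zero, Real.zero_rpow hγ.ne', mul_zero] at h4
    exact tendsto_nhdsWithin_of_tendsto_nhds h4
  have h5 : Tendsto (fun p : ℝ × (Fin n → ℝ) => v p.1 p.2 - v t p.2)
      (𝓝[Icc 0 T ×ˢ closure Ω] (t, x)) (𝓝 0) := by
    refine squeeze_zero_norm' ?_ h3
    filter_upwards [self_mem_nhdsWithin] with p hp
    exact hK p.2 hp.2 t ht p.1 hp.1
  have := h5.add h1
  simpa [ContinuousWithinAt] using this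

/-- **Theorem 5 (second part).**  Under the hypotheses of the monotonicity theorem, if in
addition `a, a_w, a_t ≥ 0` along `u`, then `Θ = sup{θ : (D^β - θ) a(u,·,·) ≥ 0} ≥ T^{-β}/Γ(1-β)`
(expressed junk-value-free: every `θ ≤ T^{-β}/Γ(1-β)` belongs to the set defining `Θ`);
in fact `D^β[a(u(·,x),·,x)](t) ≥ (t^{-β}/Γ(1-β)) a(u(t,x),t,x)` on `(0,T] × Ω`. -/
theorem theta_lower_bound {n : ℕ}
    (T β β' β'' : ℝ) (hT : 0 < T) (hβ : β ∈ Ioo (0:ℝ) 1)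
    (hβ' : β < β') (hβ'1 : β' ≤ 1) (hβ'' : 1 - β < β'') (hβ''1 : β'' ≤ 1)
    (Ω : Set (Fin n → ℝ)) (hΩo : IsOpen Ω) (hΩb : Bornology.IsBounded Ω)
    (aC : Fin n → Fin n → (Fin n → ℝ) → ℝ) (bC : Fin n → (Fin n → ℝ) → ℝ)
    (haC : ∀ i j, ContinuousOn (aC i j) (closure Ω))
    (hbC : ∀ j, ContinuousOn (bC j) (closure Ω))
    (hell : IsElliptic aC Ω)
    (z : (Fin n → ℝ) → ℝ) (hz : ContinuousOn z (closure Ω))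
    (a b aw bw at' bt : ℝ → ℝ → (Fin n → ℝ) → ℝ)
    (hawd : ∀ w t x, HasDerivAt (fun v => a v t x) (aw w t x) w)
    (hbwd : ∀ w t x, HasDerivAt (fun v => b v t x) (bw w t x) w)
    (hatd : ∀ w x, ∀ t ∈ Icc (0:ℝ) T,
      HasDerivWithinAt (fun τ => a w τ x) (at' w t x) (Icc 0 T) t)
    (hbtd : ∀ w x, ∀ t ∈ Icc (0:ℝ) T,
      HasDerivWithinAt (fun τ => b w τ x) (bt w t x) (Icc 0 T) t)
    (haH : ∀ w, MemHolderFam β'' T (nLinf Ω) (a w))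
    (haHc : ∀ w₀, Tendsto (fun w => hNorm β'' T (nLinf Ω) (fun t x => a w t x - a w₀ t x))
      (𝓝 w₀) (𝓝 0))
    (hbH : ∀ w, MemHolderFam β'' T (nLinf Ω) (b w))
    (hbHc : ∀ w₀, Tendsto (fun w => hNorm β'' T (nLinf Ω) (fun t x => b w t x - b w₀ t x))
      (𝓝 w₀) (𝓝 0))
    (hawc : ContinuousOn (fun p : ℝ × ℝ × (Fin n → ℝ) => aw p.1 p.2.1 p.2.2)
      ((univ : Set ℝ) ×ˢ (Icc 0 T ×ˢ closure Ω)))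
    (hbwc : ContinuousOn (fun p : ℝ × ℝ × (Fin n → ℝ) => bw p.1 p.2.1 p.2.2)
      ((univ : Set ℝ) ×ˢ (Icc 0 T ×ˢ closure Ω)))
    (hatc : ContinuousOn (fun p : ℝ × ℝ × (Fin n → ℝ) => at' p.1 p.2.1 p.2.2)
      ((univ : Set ℝ) ×ˢ (Icc 0 T ×ˢ closure Ω)))
    (hbtc : ContinuousOn (fun p : ℝ × ℝ × (Fin n → ℝ) => bt p.1 p.2.1 p.2.2)
      ((univ : Set ℝ) ×ˢ (Icc 0 T ×ˢ closure Ω)))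
    (u : ℝ → (Fin n → ℝ) → ℝ) (u₀ : (Fin n → ℝ) → ℝ) (g : ℝ → (Fin n → ℝ) → ℝ)
    (hu : ContinuousOn (fun p : ℝ × (Fin n → ℝ) => u p.1 p.2) (Icc 0 T ×ˢ closure Ω))
    (huL1 : MemHolderFam β'' T (nLp 1 Ω) u)
    (huxL1 : ∀ j, MemHolderFam β'' T (nLp 1 Ω) (fun t => pd j (u t)))
    (huxxL1 : ∀ i j, MemHolderFam β'' T (nLp 1 Ω) (fun t => pd i (pd j (u t))))
    (hudiffx : ∀ t ∈ Icc (0:ℝ) T, ∀ x ∈ Ω,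
      DifferentiableAt ℝ (u t) x ∧ ∀ j, DifferentiableAt ℝ (pd j (u t)) x)
    (hutdiff : ∀ x ∈ closure Ω, ∀ t ∈ Icc (0:ℝ) T,
      DifferentiableWithinAt ℝ (fun τ => u τ x) (Icc 0 T) t)
    (hut : MemHolderFam β' T (nC0 Ω) (tderiv T u))
    (hutc : ∀ t ∈ Icc (0:ℝ) T, ContinuousOn (tderiv T u t) (closure Ω))
    (hutx : ∀ j, ContinuousOn (fun p : ℝ × (Fin n → ℝ) => pd j (tderiv T u p.1) p.2)
      (Ioc 0 T ×ˢ closure Ω))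
    (hutxx : ∀ i j,
      ContinuousOn (fun p : ℝ × (Fin n → ℝ) => pd i (pd j (tderiv T u p.1)) p.2)
      (Ioc 0 T ×ˢ closure Ω))
    (heq : ∀ t ∈ Ioo (0:ℝ) T, ∀ x ∈ Ω,
      RLD β T (fun τ => u τ x - u₀ x) t =
        ellOp aC bC (u t) x + a (u t x) t x * z x + b (u t x) t x)
    (hinit : ∀ x ∈ Ω, u 0 x = u₀ x)
    (hbc : ∀ t ∈ Ioo (0:ℝ) T, ∀ x ∈ frontier Ω, u t x = g t x)
    (ha0 : ∀ x ∈ Ω, a (u₀ x) 0 x = 0)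
    (hAb0 : ∀ x ∈ Ω, ellOp aC bC u₀ x + b (u₀ x) 0 x = 0)
    (hgdiff : ∀ x ∈ frontier Ω, ∀ t ∈ Icc (0:ℝ) T,
      DifferentiableWithinAt ℝ (fun τ => g τ x) (Icc 0 T) t)
    (hgt : ∀ t ∈ Ioo (0:ℝ) T, ∀ x ∈ frontier Ω, 0 ≤ tderiv T g t x)
    (hcone : ∀ t ∈ Ioo (0:ℝ) T, ∀ x ∈ Ω,
      0 ≤ at' (u t x) t x * z x + bt (u t x) t x)
    (hapos : ∀ t ∈ Ioo (0:ℝ) T, ∀ x ∈ Ω,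
      0 ≤ a (u t x) t x ∧ 0 ≤ aw (u t x) t x ∧ 0 ≤ at' (u t x) t x) :
    (∀ θ : ℝ, θ ≤ T ^ (-β) / Real.Gamma (1 - β) →
      θ ∈ {θ' : ℝ | ∀ t ∈ Ioo (0:ℝ) T, ∀ x ∈ Ω,
        θ' * a (u t x) t x ≤ RLD β T (fun τ => a (u τ x) τ x) t}) ∧
    (∀ t ∈ Ioc (0:ℝ) T, ∀ x ∈ Ω,
      t ^ (-β) / Real.Gamma (1 - β) * a (u t x) t x ≤
        RLD β T (fun τ => a (u τ x) τ x) t) := by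
  obtain ⟨K, hK0, hK⟩ := aux_holder hβ'1 _ hut
  have hβ'0 : 0 < β' := hβ.1.trans hβ'
  have hvc := aux_joint hβ'0 _ hK hutc
  have hud : ∀ x ∈ closure Ω, ∀ t ∈ Icc (0:ℝ) T,
      HasDerivWithinAt (fun τ => u τ x) (tderiv T u t x) (Icc 0 T) t :=
    fun x hx t ht => (hutdiff x hx t ht).hasDerivWithinAt
  have huc : ∀ t ∈ Icc (0:ℝ) T, ContinuousOn (u t) (closure Ω) := by
    intro t ht
    have h1 : ContinuousOn (fun x : Fin n → ℝ => (t, x)) (closure Ω) := by fun_prop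
    exact hu.comp h1 (fun x hx => ⟨ht, hx⟩)
  have hΓ : 0 < Real.Gamma (1 - β) := Real.Gamma_pos_of_pos (by linarith [hβ.2])
  have hline : ∀ x : Fin n → ℝ, ContinuousOn (fun τ : ℝ => (τ, x)) (Icc 0 T) := by
    intro x; fun_prop
  have hvx : ∀ x ∈ closure Ω, ContinuousOn (fun τ => tderiv T u τ x) (Icc 0 T) :=
    fun x hx => hvc.comp (hline x) (fun τ hτ => ⟨hτ, hx⟩)
  have hux : ∀ x ∈ closure Ω, ContinuousOn (fun τ => u τ x) (Icc 0 T) :=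
    fun x hx => hu.comp (hline x) (fun τ hτ => ⟨hτ, hx⟩)
  -- the boundary sign
  have hfr : ∀ t ∈ Icc (0:ℝ) T, ∀ x ∈ frontier Ω, 0 ≤ tderiv T u t x := by
    intro t ht x hx
    have hxc : x ∈ closure Ω := frontier_subset_closure hx
    have h1 : ∀ t ∈ Ioo (0:ℝ) T, 0 ≤ tderiv T u t x := by
      intro t ht
      have h2 : tderiv T u t x = tderiv T g t x := by
        unfold tderiv
        apply Filter.EventuallyEq.derivWithin_eq
        · apply Filter.EventuallyEq.filter_mono _ nhdsWithin_le_nhds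
          filter_upwards [Ioo_mem_nhds ht.1 ht.2] with τ hτ using hbc τ hτ x hx
        · exact hbc t ht x hx
      rw [h2]; exact hgt t ht x hx
    have h3 : t ∈ closure (Ioo (0:ℝ) T) := by rwa [closure_Ioo hT.ne]
    have h4 : ContinuousWithinAt (fun τ => tderiv T u τ x) (Ioo 0 T) t :=
      (hvx x hxc t ht).mono Ioo_subset_Icc_self
    exact ContinuousWithinAt.closure_le h3 continuousWithinAt_const h4 h1
  -- the coefficient bound
  have hmap : ContinuousOn (fun p : ℝ × (Fin n → ℝ) => (u p.1 p.2, p.1, p.2))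
      (Icc 0 T ×ˢ closure Ω) :=
    hu.prodMk (continuousOn_fst.prodMk continuousOn_snd)
  have hmapm : MapsTo (fun p : ℝ × (Fin n → ℝ) => (u p.1 p.2, p.1, p.2))
      (Icc 0 T ×ˢ closure Ω) ((univ : Set ℝ) ×ˢ (Icc 0 T ×ˢ closure Ω)) :=
    fun p hp => ⟨mem_univ _, hp⟩
  have hzc : ContinuousOn (fun p : ℝ × (Fin n → ℝ) => z p.2) (Icc 0 T ×ˢ closure Ω) :=
    hz.comp continuousOn_snd (fun p hp => hp.2)
  have hcl : IsCompact (closure Ω) := hΩb.isCompact_closure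
  obtain ⟨M, hM⟩ := (isCompact_Icc.prod hcl).exists_bound_of_continuousOn
    (((hawc.comp hmap hmapm).mul hzc).add (hbwc.comp hmap hmapm))
  have hM' : ∀ t ∈ Icc (0:ℝ) T, ∀ x ∈ closure Ω,
      |aw (u t x) t x * z x + bw (u t x) t x| ≤ M :=
    fun t ht x hx => hM (t, x) ⟨ht, hx⟩
  have hslice : ∀ x ∈ closure Ω, ∀ c : ℝ → ℝ → (Fin n → ℝ) → ℝ,
      ContinuousOn (fun p : ℝ × ℝ × (Fin n → ℝ) => c p.1 p.2.1 p.2.2)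
        ((univ : Set ℝ) ×ˢ (Icc 0 T ×ˢ closure Ω)) →
      ContinuousOn (fun q : ℝ × ℝ => c q.1 q.2 x) (univ ×ˢ Icc 0 T) := by
    intro x hx c hc
    have h1 : ContinuousOn (fun q : ℝ × ℝ => (q.1, q.2, x)) (univ ×ˢ Icc 0 T) := by fun_prop
    exact hc.comp h1 (fun q hq => ⟨mem_univ _, hq.2, hx⟩)
  have hda : ∀ x ∈ closure Ω, ∀ t ∈ Icc (0:ℝ) T,
      HasDerivWithinAt (fun τ => a (u τ x) τ x)
        (aw (u t x) t x * tderiv T u t x + at' (u t x) t x) (Icc 0 T) t :=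
    fun x hx t ht => aux_chain (fun w t => a w t x) (fun w t => aw w t x) (fun w t => at' w t x)
      (fun w t => hawd w t x) (fun w t ht => hatd w x t ht) (hslice x hx aw hawc)
      (fun τ => u τ x) ht (hud x hx t ht)
  have hdb : ∀ x ∈ closure Ω, ∀ t ∈ Icc (0:ℝ) T,
      HasDerivWithinAt (fun τ => b (u τ x) τ x)
        (bw (u t x) t x * tderiv T u t x + bt (u t x) t x) (Icc 0 T) t :=
    fun x hx t ht => aux_chain (fun w t => b w t x) (fun w t => bw w t x) (fun w t => bt w t x)
      (fun w t => hbwd w t x) (fun w t ht => hbtd w x t ht) (hslice x hx bw hbwc)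
      (fun τ => u τ x) ht (hud x hx t ht)
  have hF : ∀ x ∈ Ω, ∀ s t, 0 ≤ s → s < t → t < T → ∀ m, 0 ≤ m →
      (∀ τ ∈ Icc s t, -m ≤ tderiv T u τ x ∧ tderiv T u τ x ≤ 0) →
      -(M * m * (t - s)) ≤ (fun t x => a (u t x) t x * z x + b (u t x) t x) t x
        - (fun t x => a (u t x) t x * z x + b (u t x) t x) s x := by
    intro x hx s t hs hst htT m hm hv
    have hxc : x ∈ closure Ω := subset_closure hx
    have hI : Icc s t ⊆ Icc 0 T := Icc_subset_Icc hs htT.le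
    have hdF := fun τ (hτ : τ ∈ Icc 0 T) => ((hda x hxc τ hτ).mul_const (z x)).add (hdb x hxc τ hτ)
    obtain ⟨ξ, hξ, he⟩ := exists_hasDerivAt_eq_slope
      (fun τ => a (u τ x) τ x * z x + b (u τ x) τ x)
      (fun τ => (aw (u τ x) τ x * tderiv T u τ x + at' (u τ x) τ x) * z x +
        (bw (u τ x) τ x * tderiv T u τ x + bt (u τ x) τ x)) hst
      (fun τ hτ => ((hdF τ (hI hτ)).continuousWithinAt).mono hI)
      (fun τ hτ => (hdF τ (hI ⟨hτ.1.le, hτ.2.le⟩)).hasDerivAt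
        (Icc_mem_nhds (by linarith [hτ.1]) (by linarith [hτ.2])))
    have hξI : ξ ∈ Icc s t := ⟨hξ.1.le, hξ.2.le⟩
    have h1 := hcone ξ ⟨by linarith [hξ.1], by linarith [hξ.2]⟩ x hx
    have h2 := hM' ξ (hI hξI) x hxc
    have h3 := hv ξ hξI
    have h4 : |tderiv T u ξ x| ≤ m := abs_le.mpr ⟨h3.1, by linarith [h3.2]⟩
    have h5 := mul_le_mul h2 h4 (abs_nonneg _) ((abs_nonneg _).trans h2)
    rw [← abs_mul] at h5
    have h6 := (abs_le.mp h5).1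
    rw [eq_div_iff (by linarith : t - s ≠ 0)] at he
    show _ ≤ (a (u t x) t x * z x + b (u t x) t x) - (a (u s x) s x * z x + b (u s x) s x)
    rw [← he]
    have h7 : -(M * m) ≤ (aw (u ξ x) ξ x * tderiv T u ξ x + at' (u ξ x) ξ x) * z x +
        (bw (u ξ x) ξ x * tderiv T u ξ x + bt (u ξ x) ξ x) := by linarith
    have h8 := mul_le_mul_of_nonneg_right h7 (by linarith : 0 ≤ t - s)
    linarith
  -- the equation in Volterra form
  have hE : ∀ x ∈ Ω, ∀ t, 0 ≤ t → t < T →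
      (Real.Gamma (1 - β))⁻¹ * (∫ τ in (0:ℝ)..t, (t - τ) ^ (-β) * tderiv T u τ x) =
        ellOp aC bC (u t) x + (a (u t x) t x * z x + b (u t x) t x) := by
    intro x hx t ht0 htT
    have hxc : x ∈ closure Ω := subset_closure hx
    rcases ht0.eq_or_lt with h | h
    · subst h
      rw [intervalIntegral.integral_same, aux_ell_congr aC bC hΩo (u 0) u₀ hx hinit, hinit x hx,
        ha0 x hx]
      linarith [hAb0 x hx]
    · have h1 := aux_RL hT hβ (fun τ => u τ x - u₀ x) (fun τ => tderiv T u τ x)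
        (fun τ hτ => (hud x hxc τ hτ).sub_const _) (hvx x hxc) (by simp [hinit x hx])
        (t := t) ⟨h, htT.le⟩
      rw [← h1, heq t ⟨h, htT⟩ x hx]; ring
  have hcomp : ∀ x ∈ Ω, ∀ s t, 0 ≤ s → s < t → t < T →
      IsLocalMin (fun y => u t y - u s y) x →
      (fun t x => a (u t x) t x * z x + b (u t x) t x) t x
        - (fun t x => a (u t x) t x * z x + b (u t x) t x) s x ≤
      (Real.Gamma (1 - β))⁻¹ * ((∫ τ in (0:ℝ)..t, (t - τ) ^ (-β) * tderiv T u τ x)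
        - ∫ τ in (0:ℝ)..s, (s - τ) ^ (-β) * tderiv T u τ x) := by
    intro x hx s t hs hst htT hmin
    have h1 := aux_ell (bC := bC) hΩo hell (u t) (u s) hx
      (hudiffx t ⟨by linarith, htT.le⟩) (hudiffx s ⟨hs, by linarith⟩) hmin
    rw [mul_sub, hE x hx t (by linarith) htT, hE x hx s hs (by linarith)]
    show (a (u t x) t x * z x + b (u t x) t x) - (a (u s x) s x * z x + b (u s x) s x) ≤ _
    linarith
  have hv := aux_mono hβ hβ' hK0 hΩo hΩb u (tderiv T u) _ hvc huc hud hK hfr hF hcomp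
  have hmain : ∀ t ∈ Ioc (0:ℝ) T, ∀ x ∈ Ω,
      t ^ (-β) / Real.Gamma (1 - β) * a (u t x) t x ≤
        RLD β T (fun τ => a (u τ x) τ x) t := by
    intro t ht x hx
    have hxc : x ∈ closure Ω := subset_closure hx
    have hcx : ∀ c : ℝ → ℝ → (Fin n → ℝ) → ℝ,
        ContinuousOn (fun p : ℝ × ℝ × (Fin n → ℝ) => c p.1 p.2.1 p.2.2)
          ((univ : Set ℝ) ×ˢ (Icc 0 T ×ˢ closure Ω)) →
        ContinuousOn (fun τ : ℝ => c (u τ x) τ x) (Icc 0 T) := by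
      intro c hc
      have h1 : ContinuousOn (fun τ : ℝ => (u τ x, τ)) (Icc 0 T) :=
        (hux x hxc).prodMk continuousOn_id
      exact (hslice x hxc c hc).comp h1 (fun τ hτ => ⟨mem_univ _, hτ⟩)
    refine aux_RL_lower hT hβ (fun τ => a (u τ x) τ x)
      (fun τ => aw (u τ x) τ x * tderiv T u τ x + at' (u τ x) τ x) (hda x hxc)
      (((hcx aw hawc).mul (hvx x hxc)).add (hcx at' hatc)) ?_ ?_ ht
    · show a (u 0 x) 0 x = 0
      rw [hinit x hx, ha0 x hx]
    · intro τ hτ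
      obtain ⟨-, h2, h3⟩ := hapos τ hτ x hx
      exact add_nonneg (mul_nonneg h2 (hv τ hτ x hxc)) h3
  refine ⟨?_, hmain⟩
  intro θ hθ t ht x hx
  refine le_trans ?_ (hmain t ⟨ht.1, ht.2.le⟩ x hx)
  apply mul_le_mul_of_nonneg_right _ (hapos t ht x hx).1
  refine hθ.trans ?_
  exact div_le_div_of_nonneg_right
    (Real.rpow_le_rpow_of_nonpos ht.1 ht.2.le (by linarith [hβ.1])) hΓ.le
end

section
/- Let X be a Banach space, β ∈ (0,1), α ∈ (0,β), T > 0, and y ∈ C([0,T];X). Then J^β y ∈ C^α([0,T];X) and ‖J^β y‖_{C^α([0,T];X)} ≤ (1/(βΓ(β)))·(T^β + 2T^{β−α})·sup_{0≤t≤T}‖y(t)‖. -/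
open Set MeasureTheory

/-- Membership in the Hölder space `C^α([0,T];X)`. -/
def MemHolderB {X : Type*} [NormedAddCommGroup X] (α T : ℝ) (w : ℝ → X) : Prop :=
  ∃ C : ℝ, ∀ s ∈ Icc (0:ℝ) T, ∀ t ∈ Icc (0:ℝ) T, ‖w t - w s‖ ≤ C * |t - s| ^ α

/-- The sup-norm `sup_{0 ≤ t ≤ T} ‖y(t)‖` of `y : [0,T] → X`. -/
noncomputable def supNormB (T : ℝ) {X : Type*} [NormedAddCommGroup X] (y : ℝ → X) : ℝ :=
  sSup ((fun t => ‖y t‖) '' Icc 0 T)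

/-- The Hölder seminorm `sup_{s ≠ t} ‖w(t) - w(s)‖ / |t-s|^α` on `[0,T]`
(the quotient being read as `0` when `s = t`). -/
noncomputable def holderSemiB (α T : ℝ) {X : Type*} [NormedAddCommGroup X] (w : ℝ → X) : ℝ :=
  sSup ((fun p : ℝ × ℝ => ‖w p.1 - w p.2‖ / |p.1 - p.2| ^ α) '' (Icc 0 T ×ˢ Icc 0 T))

/-- The Hölder norm `‖w‖_{C^α([0,T];X)}`. -/
noncomputable def holderNormB (α T : ℝ) {X : Type*} [NormedAddCommGroup X] (w : ℝ → X) : ℝ :=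
  supNormB T w + holderSemiB α T w

/-- The Riemann–Liouville fractional integral of order `β`. -/
noncomputable def JInt (β : ℝ) {X : Type*} [NormedAddCommGroup X] [NormedSpace ℝ X]
    (y : ℝ → X) (t : ℝ) : X :=
  (Real.Gamma β)⁻¹ • ∫ τ in (0:ℝ)..t, ((t - τ) ^ (β - 1)) • y τ

lemma kernel_integrable {β : ℝ} (hβ : 0 < β) (t a b : ℝ) :
    IntervalIntegrable (fun τ => (t - τ) ^ (β - 1)) volume a b := by
  have h := (intervalIntegral.intervalIntegrable_rpow' (a := t - a) (b := t - b)
    (r := β - 1) (by linarith)).comp_sub_left t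
  simpa using h

lemma kernel_integral {β : ℝ} (hβ : 0 < β) (t a b : ℝ) :
    ∫ τ in a..b, (t - τ) ^ (β - 1) = ((t - a) ^ β - (t - b) ^ β) / β := by
  rw [intervalIntegral.integral_comp_sub_left (fun x => x ^ (β - 1)) t,
    integral_rpow (Or.inl (by linarith))]
  simp

lemma integral_norm_bound {X : Type*} [NormedAddCommGroup X] [NormedSpace ℝ X]
    {β : ℝ} (hβ : 0 < β) {M a t : ℝ} (hat : a ≤ t) (y : ℝ → X)
    (hM : ∀ τ ∈ Ioc a t, ‖y τ‖ ≤ M) :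
    ‖∫ τ in a..t, ((t - τ) ^ (β - 1)) • y τ‖ ≤ M / β * (t - a) ^ β := by
  have h := intervalIntegral.norm_integral_le_of_norm_le (μ := volume)
    (f := fun τ => ((t - τ) ^ (β - 1)) • y τ)
    (g := fun τ => M * (t - τ) ^ (β - 1)) hat
    (Filter.Eventually.of_forall (fun τ hτ => by
      have h0 : 0 ≤ (t - τ) ^ (β - 1) := Real.rpow_nonneg (by linarith [hτ.2]) _
      rw [norm_smul, Real.norm_of_nonneg h0, mul_comm]
      exact mul_le_mul_of_nonneg_right (hM τ hτ) h0))
    ((kernel_integrable hβ t a t).const_mul M)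
  refine h.trans (le_of_eq ?_)
  rw [intervalIntegral.integral_const_mul, kernel_integral hβ]
  rw [sub_self, Real.zero_rpow hβ.ne']
  ring

lemma integral_diff_bound {X : Type*} [NormedAddCommGroup X] [NormedSpace ℝ X]
    {β : ℝ} (hβ : β ∈ Ioo (0:ℝ) 1) {M s t : ℝ} (hs : 0 ≤ s) (hst : s ≤ t) (y : ℝ → X)
    (hy : ContinuousOn y (Icc 0 t)) (hM0 : 0 ≤ M)
    (hM : ∀ τ ∈ Icc 0 t, ‖y τ‖ ≤ M) :
    ‖(∫ τ in (0:ℝ)..t, ((t - τ) ^ (β - 1)) • y τ) - ∫ τ in (0:ℝ)..s, ((s - τ) ^ (β - 1)) • y τ‖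
      ≤ 2 * M / β * (t - s) ^ β := by
  have hβ0 := hβ.1
  have hint : ∀ r a b, 0 ≤ a → a ≤ b → b ≤ t →
      IntervalIntegrable (fun τ => ((r - τ) ^ (β - 1)) • y τ) volume a b := by
    intro r a b ha hab hb
    refine (kernel_integrable hβ0 r a b).smul_continuousOn (hy.mono ?_)
    rw [uIcc_of_le hab]
    exact Icc_subset_Icc ha hb
  rw [← intervalIntegral.integral_add_adjacent_intervals (hint t 0 s le_rfl hs hst)
    (hint t s t hs hst le_rfl), add_sub_right_comm,
    ← intervalIntegral.integral_sub (hint t 0 s le_rfl hs hst) (hint s 0 s le_rfl hs hst)]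
  have h2 := integral_norm_bound hβ0 hst y (M := M)
    (fun τ hτ => hM τ ⟨by linarith [hτ.1], hτ.2⟩)
  have h1 := intervalIntegral.norm_integral_le_of_norm_le (μ := volume)
    (f := fun τ => ((t - τ) ^ (β - 1)) • y τ - ((s - τ) ^ (β - 1)) • y τ)
    (g := fun τ => M * ((s - τ) ^ (β - 1) - (t - τ) ^ (β - 1))) hs
    (by
      have hne : ∀ᵐ τ : ℝ ∂volume, τ ≠ s := by
        simp [ae_iff]
      filter_upwards [hne] with τ hτs hτ
      have hlt : τ < s := lt_of_le_of_ne hτ.2 hτs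
      have hle : (t - τ) ^ (β - 1) ≤ (s - τ) ^ (β - 1) :=
        Real.rpow_le_rpow_of_nonpos (by linarith) (by linarith) (by linarith [hβ.2])
      rw [← sub_smul, norm_smul, Real.norm_eq_abs, abs_sub_comm,
        abs_of_nonneg (sub_nonneg.2 hle), mul_comm]
      exact mul_le_mul_of_nonneg_right (hM τ ⟨hτ.1.le, by linarith⟩) (sub_nonneg.2 hle))
    (((kernel_integrable hβ0 s 0 s).sub (kernel_integrable hβ0 t 0 s)).const_mul M)
  rw [intervalIntegral.integral_const_mul, intervalIntegral.integral_sub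
    (kernel_integrable hβ0 s 0 s) (kernel_integrable hβ0 t 0 s), kernel_integral hβ0,
    kernel_integral hβ0, sub_self, Real.zero_rpow hβ0.ne', sub_zero, sub_zero, sub_zero] at h1
  have hmono : s ^ β ≤ t ^ β := Real.rpow_le_rpow hs hst hβ0.le
  refine (norm_add_le _ _).trans ((add_le_add h1 h2).trans ?_)
  have : M / β * (s ^ β - t ^ β) ≤ 0 :=
    mul_nonpos_of_nonneg_of_nonpos (by positivity) (by linarith)
  calc _ = M / β * (s ^ β - t ^ β) + 2 * M / β * (t - s) ^ β := by ring
    _ ≤ _ := by linarith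

/-- For `y ∈ C([0,T];X)`, `0 < α < β < 1`, one has `J^β y ∈ C^α([0,T];X)` together with the bound
`‖J^β y‖_{C^α([0,T];X)} ≤ (1/(β Γ(β))) (T^β + 2 T^{β-α}) sup_{0≤t≤T} ‖y(t)‖`. -/
theorem frac_integral_holder_bound
    {X : Type*} [NormedAddCommGroup X] [NormedSpace ℝ X] [CompleteSpace X]
    (T α β : ℝ) (hT : 0 < T) (hβ : β ∈ Ioo (0:ℝ) 1) (hα : α ∈ Ioo (0:ℝ) β)
    (y : ℝ → X) (hy : ContinuousOn y (Icc 0 T)) :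
    MemHolderB α T (JInt β y) ∧
    holderNormB α T (JInt β y) ≤
      (1 / (β * Real.Gamma β)) * (T ^ β + 2 * T ^ (β - α)) * supNormB T y := by
  have hβ0 := hβ.1
  have hα0 := hα.1
  have hG : 0 < Real.Gamma β := Real.Gamma_pos_of_pos hβ0
  set M := supNormB T y with hMdef
  have hbdd : BddAbove ((fun t => ‖y t‖) '' Icc 0 T) :=
    (isCompact_Icc.image_of_continuousOn hy.norm).bddAbove
  have hM : ∀ τ ∈ Icc 0 T, ‖y τ‖ ≤ M := fun τ hτ => le_csSup hbdd ⟨τ, hτ, rfl⟩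
  have hM0 : 0 ≤ M := (norm_nonneg _).trans (hM 0 ⟨le_rfl, hT.le⟩)
  have hsup : ∀ t ∈ Icc 0 T, ‖JInt β y t‖ ≤ 1 / (β * Real.Gamma β) * T ^ β * M := by
    intro t ht
    have h := integral_norm_bound hβ0 ht.1 y (M := M)
      (fun τ hτ => hM τ ⟨hτ.1.le, hτ.2.trans ht.2⟩)
    rw [sub_zero] at h
    have h' : t ^ β ≤ T ^ β := Real.rpow_le_rpow ht.1 ht.2 hβ0.le
    unfold JInt
    rw [norm_smul, Real.norm_of_nonneg (inv_nonneg.2 hG.le)]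
    calc _ ≤ (Real.Gamma β)⁻¹ * (M / β * T ^ β) := by gcongr; exact h.trans (by gcongr)
      _ = _ := by field_simp
  have hd : ∀ s ∈ Icc 0 T, ∀ t ∈ Icc 0 T, s ≤ t → ‖JInt β y t - JInt β y s‖ ≤
      1 / (β * Real.Gamma β) * (2 * T ^ (β - α)) * M * |t - s| ^ α := by
    intro s hs t ht hst
    have h := integral_diff_bound hβ hs.1 hst y (hy.mono (Icc_subset_Icc le_rfl ht.2)) hM0
      (fun τ hτ => hM τ ⟨hτ.1, hτ.2.trans ht.2⟩)
    have hts : 0 ≤ t - s := sub_nonneg.2 hst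
    have hp : (t - s) ^ β ≤ T ^ (β - α) * (t - s) ^ α := by
      have e : (t - s) ^ β = (t - s) ^ (β - α) * (t - s) ^ α := by
        rw [← Real.rpow_add_of_nonneg hts (by linarith [hα.2]) hα0.le, sub_add_cancel]
      rw [e]
      exact mul_le_mul_of_nonneg_right
        (Real.rpow_le_rpow hts (by linarith [ht.2, hs.1]) (by linarith [hα.2]))
        (Real.rpow_nonneg hts _)
    unfold JInt
    rw [← smul_sub, norm_smul, Real.norm_of_nonneg (inv_nonneg.2 hG.le), abs_of_nonneg hts]
    calc _ ≤ (Real.Gamma β)⁻¹ * (2 * M / β * (T ^ (β - α) * (t - s) ^ α)) := by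
          gcongr; exact h.trans (by gcongr)
      _ = _ := by field_simp
  have hd' : ∀ s ∈ Icc 0 T, ∀ t ∈ Icc 0 T, ‖JInt β y t - JInt β y s‖ ≤
      1 / (β * Real.Gamma β) * (2 * T ^ (β - α)) * M * |t - s| ^ α := by
    intro s hs t ht
    rcases le_total s t with h | h
    · exact hd s hs t ht h
    · rw [norm_sub_rev, abs_sub_comm]
      exact hd t ht s hs h
  refine ⟨⟨_, hd'⟩, ?_⟩
  have h0 : (0:ℝ) ∈ Icc 0 T := ⟨le_rfl, hT.le⟩
  have hA : supNormB T (JInt β y) ≤ 1 / (β * Real.Gamma β) * T ^ β * M := by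
    refine csSup_le ⟨_, 0, h0, rfl⟩ ?_
    rintro _ ⟨t, ht, rfl⟩
    exact hsup t ht
  have hB : holderSemiB α T (JInt β y) ≤
      1 / (β * Real.Gamma β) * (2 * T ^ (β - α)) * M := by
    refine csSup_le ⟨_, (0, 0), ⟨h0, h0⟩, rfl⟩ ?_
    rintro _ ⟨⟨t, s⟩, ⟨ht, hs⟩, rfl⟩
    exact div_le_of_le_mul₀ (Real.rpow_nonneg (abs_nonneg _) _) (by positivity) (hd' s hs t ht)
  unfold holderNormB
  calc _ ≤ _ := add_le_add hA hB
    _ = _ := by ring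
end
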